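/- If u₀, ρ₀ ∈ C^∞(ℝ) are periodic of period 1 and there is d > 0 with ρ₀(x)² ≥ d for all x ∈ ℝ, then there exists a unique classical solution (u,ρ) with u, ρ ∈ C^∞([0,∞)×ℝ), periodic of period 1 in x, of the 2CH system u_t − u_{txx} + 3uu_x − 2u_xu_{xx} − uu_{xxx} + ρρ_x = 0, ρ_t + (uρ)_x = 0, with initial data (u,ρ)|_{t=0} = (u₀,ρ₀). In particular, no wave breaking occurs. -/

import Mathlib

open MeasureTheory Real Set Filter Function

noncomputable section

/-- Lagrangian variables for the periodic 2CH system: `y` is the characteristic,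
`U` the Lagrangian velocity, `ν` the Lagrangian energy density, `r` the Lagrangian
density; `yξ` and `Uξ` are the spatial (ξ) derivatives of `y` and `U`. -/
structure LagVar where
  y : ℝ → ℝ
  U : ℝ → ℝ
  ν : ℝ → ℝ
  r : ℝ → ℝ
  yξ : ℝ → ℝ
  Uξ : ℝ → ℝ

/-- The `L^∞([0,1])` norm. -/
def supNorm01 (f : ℝ → ℝ) : ℝ := sSup ((fun x => |f x|) '' Set.Icc (0:ℝ) 1)

/-- The `L^1([0,1])` norm. -/
def L1norm01 (f : ℝ → ℝ) : ℝ := ∫ x in (0:ℝ)..1, |f x|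

/-- The `W^{1,1}_per` norm of a function `f` with (a.e.) derivative `f'`. -/
def W11norm (f f' : ℝ → ℝ) : ℝ := supNorm01 f + L1norm01 f'

/-- The `W^{1,1}_per` norm, using `deriv`. -/
def W11normD (f : ℝ → ℝ) : ℝ := supNorm01 f + L1norm01 (deriv f)

/-- Membership in the Banach space `E`: `y − id`, `U` belong to `W^{1,1}_per`
(absolutely continuous with the given derivatives `yξ`, `Uξ`) and `ν`, `r ∈ L^1_per`. -/
def InE (X : LagVar) : Prop :=
  Continuous X.y ∧ Continuous X.U ∧
  (∀ ξ, X.y (ξ + 1) = X.y ξ + 1) ∧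
  (∀ ξ, X.U (ξ + 1) = X.U ξ) ∧ (∀ ξ, X.ν (ξ + 1) = X.ν ξ) ∧
  (∀ ξ, X.r (ξ + 1) = X.r ξ) ∧ (∀ ξ, X.yξ (ξ + 1) = X.yξ ξ) ∧
  (∀ ξ, X.Uξ (ξ + 1) = X.Uξ ξ) ∧
  (∀ a b : ℝ, X.y b - X.y a = ∫ ξ in a..b, X.yξ ξ) ∧
  (∀ a b : ℝ, X.U b - X.U a = ∫ ξ in a..b, X.Uξ ξ) ∧
  IntervalIntegrable X.yξ volume 0 1 ∧ IntervalIntegrable X.Uξ volume 0 1 ∧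
  IntervalIntegrable X.ν volume 0 1 ∧ IntervalIntegrable X.r volume 0 1

/-- The `E`-norm of the difference of two elements of `E`:
`‖X − X'‖_E = ‖y − y'‖_{W^{1,1}_per} + ‖U − U'‖_{W^{1,1}_per} + ‖ν − ν'‖_{L^1_per} + ‖r − r'‖_{L^1_per}`. -/
def Edist (X X' : LagVar) : ℝ :=
  W11norm (fun ξ => X.y ξ - X'.y ξ) (fun ξ => X.yξ ξ - X'.yξ ξ)
    + W11norm (fun ξ => X.U ξ - X'.U ξ) (fun ξ => X.Uξ ξ - X'.Uξ ξ)
    + L1norm01 (fun ξ => X.ν ξ - X'.ν ξ)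
    + L1norm01 (fun ξ => X.r ξ - X'.r ξ)

/-- The bounded set `B_M ⊂ E`. -/
def InBM (M : ℝ) (X : LagVar) : Prop :=
  W11norm X.U X.Uξ + L1norm01 X.yξ + L1norm01 X.ν ≤ M

/-- The map `P` of the Lagrangian 2CH system. -/
def Pmap (X : LagVar) (ξ : ℝ) : ℝ :=
  (1 / (2 * (Real.exp 1 - 1))) *
      ∫ η in (0:ℝ)..1, Real.cosh (X.y ξ - X.y η) * ((X.U η)^2 * X.yξ η + X.ν η)
    + (1/4) * ∫ η in (0:ℝ)..1,
        Real.exp (-(Real.sign (ξ - η)) * (X.y ξ - X.y η)) * ((X.U η)^2 * X.yξ η + X.ν η)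

/-- The map `Q` of the Lagrangian 2CH system. -/
def Qmap (X : LagVar) (ξ : ℝ) : ℝ :=
  (1 / (2 * (Real.exp 1 - 1))) *
      ∫ η in (0:ℝ)..1, Real.sinh (X.y ξ - X.y η) * ((X.U η)^2 * X.yξ η + X.ν η)
    - (1/4) * ∫ η in (0:ℝ)..1,
        Real.sign (ξ - η) * Real.exp (-(Real.sign (ξ - η)) * (X.y ξ - X.y η)) *
          ((X.U η)^2 * X.yξ η + X.ν η)

/-- Membership in the set `F ⊂ E`. -/
def InF (X : LagVar) : Prop :=
  InE X ∧
  (∃ C : ℝ, ∀ᵐ ξ ∂(volume : Measure ℝ),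
      |X.yξ ξ| ≤ C ∧ |X.Uξ ξ| ≤ C ∧ |X.ν ξ| ≤ C ∧ |X.r ξ| ≤ C) ∧
  (∀ᵐ ξ ∂(volume : Measure ℝ), 0 ≤ X.yξ ξ) ∧
  (∀ᵐ ξ ∂(volume : Measure ℝ), 0 ≤ X.ν ξ) ∧
  (∃ c : ℝ, 0 < c ∧ ∀ᵐ ξ ∂(volume : Measure ℝ), c ≤ X.yξ ξ + X.ν ξ) ∧
  (∀ᵐ ξ ∂(volume : Measure ℝ),
      X.yξ ξ * X.ν ξ = (X.yξ ξ)^2 * (X.U ξ)^2 + (X.Uξ ξ)^2 + (X.r ξ)^2)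

/-- `X : ℝ → LagVar` is a (global, for `t ≥ 0`) solution of the Lagrangian 2CH system
`y_t = U`, `U_t = −Q`, `ν_t = −2QUy_ξ + (3U² − 2P)U_ξ`, `r_t = 0`. -/
def IsLagSolution (X : ℝ → LagVar) : Prop :=
  (∀ t, 0 ≤ t → InE (X t)) ∧
  (∀ ξ, ∀ t, 0 ≤ t →
    HasDerivWithinAt (fun s => (X s).y ξ) ((X t).U ξ) (Set.Ici 0) t) ∧
  (∀ ξ, ∀ t, 0 ≤ t →
    HasDerivWithinAt (fun s => (X s).U ξ) (-(Qmap (X t) ξ)) (Set.Ici 0) t) ∧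
  (∀ ξ, ∀ t, 0 ≤ t →
    HasDerivWithinAt (fun s => (X s).ν ξ)
      (-2 * Qmap (X t) ξ * (X t).U ξ * (X t).yξ ξ
        + (3 * ((X t).U ξ)^2 - 2 * Pmap (X t) ξ) * (X t).Uξ ξ) (Set.Ici 0) t) ∧
  (∀ ξ, ∀ t, 0 ≤ t →
    HasDerivWithinAt (fun s => (X s).r ξ) 0 (Set.Ici 0) t)

/-- A relabeling function `f`, together with its inverse and its derivative. -/
structure Relabel where
  f : ℝ → ℝ
  finv : ℝ → ℝ
  fξ : ℝ → ℝ

/-- Membership in the relabeling group `G`. -/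
def InG (g : Relabel) : Prop :=
  Function.LeftInverse g.finv g.f ∧ Function.RightInverse g.finv g.f ∧
  (∀ ξ, g.f (ξ + 1) = g.f ξ + 1) ∧
  (∃ K : NNReal, LipschitzWith K g.f) ∧
  (∃ K : NNReal, LipschitzWith K g.finv) ∧
  (∀ a b : ℝ, g.f b - g.f a = ∫ ξ in a..b, g.fξ ξ)

/-- The action `X • f = (y∘f, U∘f, (ν∘f)f_ξ, (r∘f)f_ξ)` of a relabeling function on `F`. -/
def act (X : LagVar) (g : Relabel) : LagVar where
  y := fun ξ => X.y (g.f ξ)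
  U := fun ξ => X.U (g.f ξ)
  ν := fun ξ => X.ν (g.f ξ) * g.fξ ξ
  r := fun ξ => X.r (g.f ξ) * g.fξ ξ
  yξ := fun ξ => X.yξ (g.f ξ) * g.fξ ξ
  Uξ := fun ξ => X.Uξ (g.f ξ) * g.fξ ξ

/-- The inverse of a relabeling function. -/
def Relabel.inverse (g : Relabel) : Relabel := ⟨g.finv, g.f, deriv g.finv⟩

/-- `F₀ = {X ∈ F : y_ξ + ν = 1 + h a.e.}`, where `h = ∫₀¹ ν`. -/
def InF0 (X : LagVar) : Prop :=
  InF X ∧ ∀ᵐ ξ ∂(volume : Measure ℝ), X.yξ ξ + X.ν ξ = 1 + ∫ η in (0:ℝ)..1, X.ν η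

/-- `H = {X ∈ F₀ : ∫₀¹ y dξ = 0}`. -/
def InH (X : LagVar) : Prop := InF0 X ∧ (∫ ξ in (0:ℝ)..1, X.y ξ) = 0

/-- `H^M = {X ∈ H : h ≤ M}`. -/
def InHM (M : ℝ) (X : LagVar) : Prop := InH X ∧ (∫ ξ in (0:ℝ)..1, X.ν ξ) ≤ M

/-- The relabeling function `f(ξ) = (1/(1+h))(y(ξ) + ∫₀^ξ ν)` associated with `X ∈ F`. -/
def relabelOf (X : LagVar) : Relabel :=
  ⟨fun ξ => (1 / (1 + ∫ η in (0:ℝ)..1, X.ν η)) * (X.y ξ + ∫ η in (0:ℝ)..ξ, X.ν η),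
   Function.invFun
     (fun ξ => (1 / (1 + ∫ η in (0:ℝ)..1, X.ν η)) * (X.y ξ + ∫ η in (0:ℝ)..ξ, X.ν η)),
   deriv (fun ξ => (1 / (1 + ∫ η in (0:ℝ)..1, X.ν η)) * (X.y ξ + ∫ η in (0:ℝ)..ξ, X.ν η))⟩

/-- The projection `Π₁ : F → F₀`, `Π₁(X) = X • f⁻¹`. -/
def Pi1 (X : LagVar) : LagVar := act X (relabelOf X).inverse

/-- The shift `(Π₂ X)(ξ) = X(ξ − a)`. -/
def shiftX (X : LagVar) (a : ℝ) : LagVar :=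
  ⟨fun ξ => X.y (ξ - a), fun ξ => X.U (ξ - a), fun ξ => X.ν (ξ - a), fun ξ => X.r (ξ - a),
   fun ξ => X.yξ (ξ - a), fun ξ => X.Uξ (ξ - a)⟩

/-- The projection `Π = Π₂ ∘ Π₁ : F → H`. -/
def PiMap (X : LagVar) : LagVar := shiftX (Pi1 X) (∫ ξ in (0:ℝ)..1, (Pi1 X).y ξ)

/-- Membership in the set `D` of Eulerian data: `u ∈ H^1_per` (with derivative `ux`),
`ρ ∈ L^2_per`, and `μ` a positive periodic Radon measure with
`μ_ac = (u² + u_x² + ρ²) dx`. -/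
def InD (u ux ρ : ℝ → ℝ) (μ : Measure ℝ) : Prop :=
  Continuous u ∧
  (∀ x, u (x + 1) = u x) ∧ (∀ x, ux (x + 1) = ux x) ∧ (∀ x, ρ (x + 1) = ρ x) ∧
  (∀ a b : ℝ, u b - u a = ∫ x in a..b, ux x) ∧
  IntervalIntegrable (fun x => (ux x)^2) volume 0 1 ∧
  IntervalIntegrable (fun x => (ρ x)^2) volume 0 1 ∧
  IsLocallyFiniteMeasure μ ∧
  μ.map (fun x => x + 1) = μ ∧
  (∃ μs : Measure ℝ, μs.MutuallySingular volume ∧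
    μ = volume.withDensity (fun x => ENNReal.ofReal ((u x)^2 + (ux x)^2 + (ρ x)^2)) + μs)

/-- `F_μ(x) = μ([0,x))` for `x ≥ 0` and `−μ([x,0))` for `x < 0`. -/
def Fmu (μ : Measure ℝ) (x : ℝ) : ℝ :=
  if 0 ≤ x then (μ (Set.Ico 0 x)).toReal else -((μ (Set.Ico x 0)).toReal)

/-- The map `L̃ : D → F` from Eulerian to Lagrangian coordinates. -/
def Ltilde (u ρ : ℝ → ℝ) (μ : Measure ℝ) : LagVar :=
  let h : ℝ := (μ (Set.Ico (0:ℝ) 1)).toReal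
  let y : ℝ → ℝ := fun ξ => sSup {x : ℝ | Fmu μ x + x < (1 + h) * ξ}
  { y := y
    U := fun ξ => u (y ξ)
    ν := fun ξ => (1 + h) - deriv y ξ
    r := fun ξ => ρ (y ξ) * deriv y ξ
    yξ := deriv y
    Uξ := deriv (fun ξ => u (y ξ)) }

/-- The relation `(u,ρ,μ) = M(X)`: `u(x) = U(ξ)` for `x = y(ξ)`, `μ = y_#(ν dξ)` and
`ρ dx = y_#(r dξ)` (so that in particular `y_#(r dξ)` is absolutely continuous). -/
def MRel (X : LagVar) (u ρ : ℝ → ℝ) (μ : Measure ℝ) : Prop :=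
  (∀ ξ, u (X.y ξ) = X.U ξ) ∧
  μ = Measure.map X.y (volume.withDensity fun ξ => ENNReal.ofReal (X.ν ξ)) ∧
  (∀ φ : ℝ → ℝ, Continuous φ → HasCompactSupport φ →
    (∫ x, φ x * ρ x) = ∫ ξ, φ (X.y ξ) * X.r ξ)

/-- `J(X_α,X_β) = inf_{f,g ∈ G} ‖X_α • f − X_β • g‖_E`. -/
def Jfun (Xa Xb : LagVar) : ℝ :=
  sInf {v : ℝ | ∃ f g : Relabel, InG f ∧ InG g ∧ v = Edist (act Xa f) (act Xb g)}

/-- `d(X_α,X_β) = inf Σ J(X_{n−1},X_n)` over finite sequences in `F` joining `X_α` to `X_β`. -/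
def dfun (Xa Xb : LagVar) : ℝ :=
  sInf {v : ℝ | ∃ N : ℕ, 1 ≤ N ∧ ∃ Z : ℕ → LagVar,
    (∀ n, n ≤ N → InF (Z n)) ∧ Z 0 = Xa ∧ Z N = Xb ∧
    v = ∑ n ∈ Finset.range N, Jfun (Z n) (Z (n+1))}

/-- `d_M(X_α,X_β) = inf Σ J(X_{n−1},X_n)` over finite sequences in `H^M` joining `X_α` to `X_β`. -/
def dM (M : ℝ) (Xa Xb : LagVar) : ℝ :=
  sInf {v : ℝ | ∃ N : ℕ, 1 ≤ N ∧ ∃ Z : ℕ → LagVar,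
    (∀ n, n ≤ N → InHM M (Z n)) ∧ Z 0 = Xa ∧ Z N = Xb ∧
    v = ∑ n ∈ Finset.range N, Jfun (Z n) (Z (n+1))}

/-- The metric `d_{D^M}` on Eulerian sets of bounded energy. -/
def dD (M : ℝ) (u ρ : ℝ → ℝ) (μ : Measure ℝ) (u' ρ' : ℝ → ℝ) (μ' : Measure ℝ) : ℝ :=
  dM M (PiMap (Ltilde u ρ μ)) (PiMap (Ltilde u' ρ' μ'))

/-- `D^M = {(u,ρ,μ) ∈ D : μ([0,1)) ≤ M}`. -/
def InDM (Mc : ℝ) (u ux ρ : ℝ → ℝ) (μ : Measure ℝ) : Prop :=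
  InD u ux ρ μ ∧ (μ (Set.Ico (0:ℝ) 1)).toReal ≤ Mc

/-- The support of a measure on `ℝ`. -/
def msupport (μ : Measure ℝ) : Set ℝ :=
  {x : ℝ | ∀ ε : ℝ, 0 < ε → 0 < μ (Set.Ioo (x - ε) (x + ε))}

/-- The Eulerian function `P(t,·)` computed from `u(t,·)` and `μ(t)`. -/
def Peul (u : ℝ → ℝ) (μ : Measure ℝ) (x : ℝ) : ℝ :=
  (1 / (2 * (Real.exp 1 - 1))) * ∫ z in (0:ℝ)..1, Real.cosh (x - z) * (u z)^2
    + (1 / (2 * (Real.exp 1 - 1))) * ∫ z in Set.Ico (0:ℝ) 1, Real.cosh (x - z) ∂μ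
    + (1/4) * ∫ z in (0:ℝ)..1, Real.exp (-|x - z|) * (u z)^2
    + (1/4) * ∫ z in Set.Ico (0:ℝ) 1, Real.exp (-|x - z|) ∂μ

/-- Partial derivative in time. -/
def partialT (u : ℝ → ℝ → ℝ) (t x : ℝ) : ℝ := deriv (fun s => u s x) t

/-- Partial derivative in space. -/
def partialX (u : ℝ → ℝ → ℝ) (t x : ℝ) : ℝ := deriv (fun z => u t z) x

/-- `(u,ρ)` is a classical solution, for `t > 0`, of the 2CH system with parameters `κ, η`. -/
def Is2CH (κ η : ℝ) (u ρ : ℝ → ℝ → ℝ) : Prop :=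
  ∀ t, 0 < t → ∀ x,
    partialT u t x - partialT (partialX (partialX u)) t x + κ * partialX u t x
        + 3 * u t x * partialX u t x
        - 2 * partialX u t x * partialX (partialX u) t x
        - u t x * partialX (partialX (partialX u)) t x
        + η * ρ t x * partialX ρ t x = 0 ∧
    partialT ρ t x + partialX (fun s z => u s z * ρ s z) t x = 0

/-- Spatial periodicity (period 1). -/
def SpacePeriodic (φ : ℝ → ℝ → ℝ) : Prop := ∀ t x, φ t (x + 1) = φ t x

/-- Spatially periodic test functions, smooth and compactly supported in time `[0,∞)`. -/
def TestFn (φ : ℝ → ℝ → ℝ) : Prop :=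
  ContDiff ℝ (⊤ : ℕ∞) (Function.uncurry φ) ∧ SpacePeriodic φ ∧
  ∃ T : ℝ, ∀ t, T ≤ t → ∀ x, φ t x = 0

/-- Test functions as above, vanishing also near `t = 0` (support in `(0,∞)`). -/
def TestFn0 (φ : ℝ → ℝ → ℝ) : Prop :=
  TestFn φ ∧ ∃ ε : ℝ, 0 < ε ∧ ∀ t, t ≤ ε → ∀ x, φ t x = 0

/-- Membership in `W^{p,∞}(a,b)`: for `p = 0` it is `L^∞(a,b)`; for `p = k+1` it is
`C^{k,1}`, i.e. `C^k` with Lipschitz `k`-th derivative. -/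
def MemWpInf (p : ℕ) (f : ℝ → ℝ) (a b : ℝ) : Prop :=
  match p with
  | 0 => ∃ C : ℝ, ∀ᵐ x ∂(volume.restrict (Set.Ioo a b)), |f x| ≤ C
  | (k+1) => ContDiffOn ℝ k f (Set.Ioo a b) ∧
      ∃ K : NNReal, LipschitzOnWith K (iteratedDerivWithin k f (Set.Ioo a b)) (Set.Ioo a b)

/-- `(u,ρ,μ)` is `p`-regular on `(a,b)`: `u ∈ W^{p,∞}(a,b)`, `ρ ∈ W^{p−1,∞}(a,b)` (as an
a.e.-defined function, i.e. some representative of `ρ` belongs to `W^{p−1,∞}(a,b)`),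
and `μ = μ_ac` on `(a,b)`. -/
def pRegular (p : ℕ) (u ρ : ℝ → ℝ) (μ : Measure ℝ) (a b : ℝ) : Prop :=
  MemWpInf p u a b ∧
  (∃ g : ℝ → ℝ, (∀ᵐ x ∂(volume.restrict (Set.Ioo a b)), g x = ρ x) ∧
    MemWpInf (p - 1) g a b) ∧
  (μ.singularPart volume) (Set.Ioo a b) = 0

end

set_option linter.unusedSectionVars false

namespace TCH

section Abstract

variable {E : Type*} [NormedAddCommGroup E] [NormedSpace ℝ E]

/-- Extension of a continuous curve on `[0,1]` to `ℝ`. -/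
noncomputable def ext (x : C(Icc (0:ℝ) 1, E)) (t : ℝ) : E := x (projIcc 0 1 zero_le_one t)

theorem ext_continuous (x : C(Icc (0:ℝ) 1, E)) : Continuous (ext x) :=
  x.continuous.comp continuous_projIcc

theorem ext_coe (x : C(Icc (0:ℝ) 1, E)) (t : Icc (0:ℝ) 1) : ext x t = x t := by
  simp [ext]

theorem ext_of_mem (x : C(Icc (0:ℝ) 1, E)) {t : ℝ} (ht : t ∈ Icc (0:ℝ) 1) :
    ext x t = x ⟨t, ht⟩ := by
  simp [ext, projIcc_of_mem zero_le_one ht]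

theorem ext_norm_le (x : C(Icc (0:ℝ) 1, E)) (t : ℝ) : ‖ext x t‖ ≤ ‖x‖ :=
  x.norm_coe_le_norm _

/-- The integration operator. -/
noncomputable def Jop : C(Icc (0:ℝ) 1, E) →L[ℝ] C(Icc (0:ℝ) 1, E) :=
  LinearMap.mkContinuous
    { toFun := fun x => ⟨fun t => ∫ s in (0:ℝ)..t, ext x s,
        (intervalIntegral.continuous_primitive
          (fun a b => (ext_continuous x).intervalIntegrable a b) 0).comp continuous_subtype_val⟩
      map_add' := by
        intro x y
        ext t
        simp only [ContinuousMap.coe_mk, ContinuousMap.add_apply]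
        rw [← intervalIntegral.integral_add ((ext_continuous x).intervalIntegrable _ _)
          ((ext_continuous y).intervalIntegrable _ _)]
        rfl
      map_smul' := by
        intro c x
        ext t
        simp only [ContinuousMap.coe_mk, ContinuousMap.smul_apply, RingHom.id_apply]
        rw [← intervalIntegral.integral_smul]
        rfl } 1 (by
      intro x
      rw [ContinuousMap.norm_le _ (by positivity)]
      intro t
      have := intervalIntegral.norm_integral_le_of_norm_le_const (a := (0:ℝ)) (b := t)
        (f := ext x) (C := ‖x‖) (fun s _ => ext_norm_le x s)
      refine this.trans ?_
      have h0 := t.2.1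
      have h1 := t.2.2
      rw [sub_zero, abs_of_nonneg h0]
      nlinarith [norm_nonneg x])

theorem Jop_apply (x : C(Icc (0:ℝ) 1, E)) (t : Icc (0:ℝ) 1) :
    Jop x t = ∫ s in (0:ℝ)..t, ext x s := rfl

theorem volterra_pow (B : C(Icc (0:ℝ) 1, E) →L[ℝ] C(Icc (0:ℝ) 1, E)) (M : ℝ) (hM : 0 ≤ M)
    (hB : ∀ v t, ‖B v t‖ ≤ M * ‖v t‖) (n : ℕ) (v : C(Icc (0:ℝ) 1, E)) (t : Icc (0:ℝ) 1) :
    ‖((Jop ∘L B) ^ n) v t‖ ≤ M ^ n * (t:ℝ) ^ n / n.factorial * ‖v‖ := by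
  induction n generalizing t with
  | zero => simpa using v.norm_coe_le_norm t
  | succ n ih =>
    rw [pow_succ']
    change ‖Jop (B (((Jop ∘L B) ^ n) v)) t‖ ≤ _
    rw [Jop_apply]
    have h0 := t.2.1
    have h1 := t.2.2
    have hIntg : ∫ s in (0:ℝ)..t, M ^ (n+1) * s ^ n / n.factorial * ‖v‖
        = M ^ (n+1) * (t:ℝ) ^ (n+1) / (n+1).factorial * ‖v‖ := by
      have : (fun s : ℝ => M ^ (n+1) * s ^ n / n.factorial * ‖v‖)
        = fun s => (M ^ (n+1) / n.factorial * ‖v‖) * s ^ n := by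
        ext s; ring
      rw [this, intervalIntegral.integral_const_mul, integral_pow, Nat.factorial_succ]
      push_cast
      have : (n.factorial : ℝ) ≠ 0 := by positivity
      have : (n : ℝ) + 1 ≠ 0 := by positivity
      field_simp
      simp
    rw [← hIntg]
    apply intervalIntegral.norm_integral_le_of_norm_le h0
    · refine Filter.Eventually.of_forall fun s hs => ?_
      have hs' : s ∈ Icc (0:ℝ) 1 := ⟨hs.1.le, hs.2.trans h1⟩
      rw [ext_of_mem _ hs']
      refine (hB _ _).trans ?_
      have := mul_le_mul_of_nonneg_left (ih ⟨s, hs'⟩) hM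
      refine this.trans (le_of_eq ?_)
      simp only [pow_succ]
      ring
    · apply Continuous.intervalIntegrable
      fun_prop

theorem volterra_isUnit [CompleteSpace E]
    (B : C(Icc (0:ℝ) 1, E) →L[ℝ] C(Icc (0:ℝ) 1, E)) (M : ℝ) (hM : 0 ≤ M)
    (hB : ∀ v t, ‖B v t‖ ≤ M * ‖v t‖) : IsUnit (1 - Jop ∘L B) := by
  set K := Jop ∘L B with hK
  have hnorm : ∀ n : ℕ, ‖K ^ n‖ ≤ M ^ n / n.factorial := by
    intro n
    apply ContinuousLinearMap.opNorm_le_bound _ (by positivity)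
    intro v
    rw [ContinuousMap.norm_le _ (by positivity)]
    intro t
    refine (volterra_pow B M hM hB n v t).trans ?_
    have h0 := t.2.1
    have h1 := t.2.2
    gcongr
    have : (t:ℝ) ^ n ≤ 1 := pow_le_one₀ h0 h1
    have : 0 ≤ M ^ n := by positivity
    nlinarith
  have hlim := FloorSemiring.tendsto_pow_div_factorial_atTop M
  obtain ⟨n, hn⟩ := ((hlim.eventually (gt_mem_nhds one_pos)).and (eventually_ge_atTop 1)).exists
  have h1 : IsUnit (1 - K ^ n) := by
    have hlt : ‖K ^ n‖ < 1 := (hnorm n).trans_lt hn.1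
    exact isUnit_one_sub_of_norm_lt_one
      (R := C(Icc (0:ℝ) 1, E) →L[ℝ] C(Icc (0:ℝ) 1, E)) (x := K ^ n) hlt
  have h2 : (∑ i ∈ Finset.range n, K ^ i) * (1 - K) = 1 - K ^ n := geom_sum_mul_neg K n
  have h3 : (1 - K) * (∑ i ∈ Finset.range n, K ^ i) = 1 - K ^ n := mul_neg_geom_sum K n
  have hc : Commute (1 - K) (∑ i ∈ Finset.range n, K ^ i) := by
    rw [Commute, SemiconjBy, h2, h3]
  rw [← h3] at h1
  exact ((hc.isUnit_mul_iff).1 h1).1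

/-- A vector field together with its (smooth) superposition operator. -/
structure Good (F : E → E) (FF : C(Icc (0:ℝ) 1, E) → C(Icc (0:ℝ) 1, E)) : Prop where
  h : ∀ x t, FF x t = F (x t)
  c : ContDiff ℝ (⊤ : ℕ∞) FF
  lip : ∀ R : ℝ, ∃ L : NNReal, LipschitzOnWith L F (Metric.closedBall 0 R)

/-- `x` solves `x' = l F(x)`, `x(0) = x0` on `[0,1]`. -/
def IsSol (F : E → E) (l : ℝ) (x0 : E) (x : C(Icc (0:ℝ) 1, E)) : Prop :=
  ∀ t : Icc (0:ℝ) 1, x t = x0 + l • ∫ s in (0:ℝ)..t, F (ext x s)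

variable {F : E → E} {FF : C(Icc (0:ℝ) 1, E) → C(Icc (0:ℝ) 1, E)}

theorem Good.cF (g : Good F FF) : ContDiff ℝ (⊤ : ℕ∞) F := by
  have : F = fun e => (ContinuousMap.evalCLM ℝ (⟨0, by simp⟩ : Icc (0:ℝ) 1))
      (FF ((ContinuousLinearMap.const ℝ (Icc (0:ℝ) 1)) e)) := by
    ext e
    simp [g.h]
  rw [this]
  have := g.c
  fun_prop

theorem Good.isSol_iff (g : Good F FF) (l : ℝ) (x0 : E) (x : C(Icc (0:ℝ) 1, E)) :
    IsSol F l x0 x ↔ x = ContinuousLinearMap.const ℝ (Icc (0:ℝ) 1) x0 + l • Jop (FF x) := by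
  rw [ContinuousMap.ext_iff]
  refine forall_congr' fun t => ?_
  simp only [ContinuousMap.add_apply, ContinuousMap.smul_apply, Jop_apply]
  have : ext (FF x) = fun s => F (ext x s) := by
    ext s
    simp [ext, g.h]
  rw [this]
  rfl

theorem Good.isUnit [CompleteSpace E] (g : Good F FF) (l : ℝ) (x : C(Icc (0:ℝ) 1, E)) :
    IsUnit (1 - l • (Jop ∘L fderiv ℝ FF x)) := by
  obtain ⟨L, hL⟩ := g.lip (‖x‖ + 1)
  have h1 : ∀ v t, (fderiv ℝ FF x v) t = fderiv ℝ F (x t) (v t) := by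
    intro v t
    have hF : HasFDerivAt F (fderiv ℝ F (x t)) (x t) :=
      ((g.cF.differentiable (by simp)) (x t)).hasFDerivAt
    have hFF : HasFDerivAt FF (fderiv ℝ FF x) x :=
      ((g.c.differentiable (by simp)) x).hasFDerivAt
    have e1 := (ContinuousMap.evalCLM ℝ t : C(Icc (0:ℝ) 1, E) →L[ℝ] E).hasFDerivAt.comp x hFF
    have e2 := HasFDerivAt.comp (f := fun y : C(Icc (0:ℝ) 1, E) => y t) x hF
      (ContinuousMap.evalCLM ℝ t : C(Icc (0:ℝ) 1, E) →L[ℝ] E).hasFDerivAt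
    have e3 : (fun y => (ContinuousMap.evalCLM ℝ t : C(Icc (0:ℝ) 1, E) →L[ℝ] E) (FF y))
      = fun y => F (y t) := by
      ext y
      simp [g.h]
    have e5 : HasFDerivAt (fun y => (ContinuousMap.evalCLM ℝ t : C(Icc (0:ℝ) 1, E) →L[ℝ] E) (FF y))
        (fderiv ℝ F (x t) ∘L ContinuousMap.evalCLM ℝ t) x := by
      rw [e3]; exact e2
    have e4 := HasFDerivAt.unique e1 e5
    have := congrArg (fun A => A v) e4
    simpa using this
  have h2 : ∀ t, ‖fderiv ℝ F (x t)‖ ≤ L := by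
    intro t
    have hF : HasFDerivAt F (fderiv ℝ F (x t)) (x t) :=
      ((g.cF.differentiable (by simp)) (x t)).hasFDerivAt
    refine hF.le_of_lipschitzOn ?_ hL
    apply Metric.closedBall_mem_nhds_of_mem
    rw [Metric.mem_ball, dist_zero_right]
    have := x.norm_coe_le_norm t
    linarith
  have h3 : l • (Jop ∘L fderiv ℝ FF x) = Jop ∘L (l • fderiv ℝ FF x) := by
    ext v t
    simp
  rw [h3]
  apply volterra_isUnit _ (|l| * L) (by positivity)
  intro v t
  simp only [_root_.smul_apply, ContinuousMap.smul_apply, norm_smul, h1, Real.norm_eq_abs]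
  rw [mul_assoc]
  gcongr
  exact (ContinuousLinearMap.le_opNorm _ _).trans (by gcongr; exact h2 t)

/-- Local smooth dependence. -/
theorem Good.local_flow [CompleteSpace E] (g : Good F FF) (l : ℝ) (x0 : E) (x : C(Icc (0:ℝ) 1, E))
    (hx : IsSol F l x0 x) :
    ∃ G : ℝ × E → C(Icc (0:ℝ) 1, E), ContDiffAt ℝ (⊤ : ℕ∞) G (l, x0) ∧
      ∀ᶠ v in nhds (l, x0), IsSol F v.1 v.2 (G v) := by
  set Psi : (ℝ × E) × C(Icc (0:ℝ) 1, E) → C(Icc (0:ℝ) 1, E) :=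
    fun v => v.2 - ContinuousLinearMap.const ℝ (Icc (0:ℝ) 1) v.1.2 - v.1.1 • Jop (FF v.2) with hPsi
  have hc : ContDiff ℝ (⊤ : ℕ∞) Psi := by
    have := g.c
    fun_prop
  have hiff : ∀ v : (ℝ × E) × C(Icc (0:ℝ) 1, E), Psi v = 0 ↔ IsSol F v.1.1 v.1.2 v.2 := by
    intro v
    rw [g.isSol_iff, hPsi]
    constructor
    · intro h
      have h' := sub_eq_zero.1 h
      rw [← h']; abel
    · intro h
      simp only
      rw [sub_sub, sub_eq_zero]
      exact h
  have h0 : Psi ((l, x0), x) = 0 := (hiff _).2 hx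
  have hder : fderiv ℝ Psi ((l, x0), x) ∘L .inr ℝ (ℝ × E) C(Icc (0:ℝ) 1, E)
      = 1 - l • (Jop ∘L fderiv ℝ FF x) := by
    have e1 : HasFDerivAt Psi (fderiv ℝ Psi ((l, x0), x)) ((l, x0), x) :=
      ((hc.differentiable (by simp)) _).hasFDerivAt
    have e2 : HasFDerivAt (fun y : C(Icc (0:ℝ) 1, E) => ((l, x0), y))
      (.inr ℝ (ℝ × E) C(Icc (0:ℝ) 1, E)) x := hasFDerivAt_prodMk_right (l, x0) x
    have e3 := HasFDerivAt.comp x e1 e2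
    have hFF : HasFDerivAt FF (fderiv ℝ FF x) x :=
      ((g.c.differentiable (by simp)) x).hasFDerivAt
    have e4 : HasFDerivAt (fun y : C(Icc (0:ℝ) 1, E) =>
        y - ContinuousLinearMap.const ℝ (Icc (0:ℝ) 1) x0 - l • Jop (FF y))
        (1 - l • (Jop ∘L fderiv ℝ FF x)) x :=
      ((hasFDerivAt_id x).sub_const _).sub
        (((Jop (E := E)).hasFDerivAt.comp x hFF).const_smul l)
    exact e3.unique e4
  have hinv : (fderiv ℝ Psi ((l, x0), x) ∘L
      .inr ℝ (ℝ × E) C(Icc (0:ℝ) 1, E)).IsInvertible := by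
    rw [hder]
    obtain ⟨u, hu⟩ := g.isUnit l x
    rw [← hu]
    exact ⟨ContinuousLinearEquiv.unitsEquiv ℝ _ u, rfl⟩
  have hcd : ContDiffAt ℝ (⊤ : ℕ∞) Psi ((l, x0), x) := hc.contDiffAt
  refine ⟨hcd.implicitFunction (by simp) hinv, hcd.contDiffAt_implicitFunction (by simp) hinv, ?_⟩
  have := hcd.eventually_apply_implicitFunction (by simp) hinv
  filter_upwards [this] with v hv
  rw [h0] at hv
  exact (hiff _).1 hv

theorem IsSol.hasDerivAt_aux [CompleteSpace E] (hF : Continuous F) {l : ℝ} {x0 : E}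
    {x : C(Icc (0:ℝ) 1, E)} (hx : IsSol F l x0 x) (t : ℝ) (ht : t ∈ Icc (0:ℝ) 1) :
    HasDerivWithinAt (ext x) (l • F (ext x t)) (Icc 0 1) t := by
  have hcont : Continuous (fun s => F (ext x s)) := hF.comp (ext_continuous x)
  have h1 : HasDerivAt (fun t => x0 + l • ∫ s in (0:ℝ)..t, F (ext x s)) (l • F (ext x t)) t :=
    ((intervalIntegral.integral_hasDerivAt_right (hcont.intervalIntegrable _ _)
      (hcont.stronglyMeasurableAtFilter _ _) hcont.continuousAt).const_smul l).const_add x0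
  refine h1.hasDerivWithinAt.congr_of_mem ?_ ht
  intro s hs
  rw [ext_of_mem _ hs]
  exact hx ⟨s, hs⟩

theorem IsSol.hasDerivRight [CompleteSpace E] (hF : Continuous F) {l : ℝ} {x0 : E}
    {x : C(Icc (0:ℝ) 1, E)} (hx : IsSol F l x0 x) (t : ℝ) (ht : t ∈ Ico (0:ℝ) 1) :
    HasDerivWithinAt (ext x) (l • F (ext x t)) (Ici t) t := by
  have := hx.hasDerivAt_aux hF t ⟨ht.1, ht.2.le⟩
  refine this.mono_of_mem_nhdsWithin ?_
  exact mem_of_superset (Icc_mem_nhdsGE ht.2) (Icc_subset_Icc_left ht.1)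

theorem IsSol.zero {l : ℝ} {x0 : E} {x : C(Icc (0:ℝ) 1, E)} (hx : IsSol F l x0 x) :
    ext x 0 = x0 := by
  rw [ext_of_mem x (t := 0) (by simp), hx]
  simp

theorem Good.dist_le [CompleteSpace E] (g : Good F FF) {l l' : ℝ} {x0 : E}
    {x x' : C(Icc (0:ℝ) 1, E)} {T M : ℝ} {L : NNReal}
    (hL : LipschitzOnWith L F (Metric.closedBall 0 M))
    (hM : 0 ≤ M) (hT : |l| ≤ T) 
    (hx : IsSol F l x0 x) (hx' : IsSol F l' x0 x') (hxM : ∀ t, ‖x t‖ ≤ M) (hxM' : ∀ t, ‖x' t‖ ≤ M) :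
    dist x x' ≤ gronwallBound 0 (T.toNNReal * L : NNReal) ((‖F 0‖ + L * M) * |l - l'|) 1 := by
  have hT0 : 0 ≤ T := (abs_nonneg l).trans hT
  have hF0 : ∀ e, ‖e‖ ≤ M → ‖F e‖ ≤ ‖F 0‖ + L * M := by
    intro e he
    have := hL.dist_le_mul e (by simpa using he) 0 (by simpa using hM)
    rw [dist_eq_norm, dist_zero_right] at this
    have h2 : ‖F e‖ ≤ ‖F 0‖ + ‖F e - F 0‖ := by
      have := norm_add_le (F 0) (F e - F 0)
      simpa using this
    have : (L:ℝ) * ‖e‖ ≤ L * M := by gcongr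
    linarith
  have key := dist_le_of_approx_trajectories_ODE_of_mem (a := 0) (b := 1) (f := ext x) (g := ext x')
    (f' := fun t => l • F (ext x t)) (g' := fun t => l' • F (ext x' t))
    (v := fun _ e => l • F e) (s := fun _ => Metric.closedBall 0 M) (K := T.toNNReal * L)
    (εf := 0) (εg := (‖F 0‖ + L * M) * |l - l'|) (δ := 0)
    (by
      intro t _
      refine LipschitzOnWith.of_dist_le_mul fun a ha b hb => ?_
      rw [dist_smul₀, Real.norm_eq_abs]
      have := hL.dist_le_mul a ha b hb
      push_cast
      rw [Real.coe_toNNReal _ hT0, mul_assoc]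
      gcongr)
    (ext_continuous x).continuousOn (fun t ht => hx.hasDerivRight g.cF.continuous t ht)
    (by intro t _; simp)
    (by intro t _; simpa [ext] using hxM (projIcc 0 1 zero_le_one t))
    (ext_continuous x').continuousOn (fun t ht => hx'.hasDerivRight g.cF.continuous t ht)
    (by
      intro t _
      rw [dist_eq_norm, ← sub_smul, norm_smul, Real.norm_eq_abs, abs_sub_comm, mul_comm]
      gcongr
      exact hF0 _ (hxM' _))
    (by intro t _; simpa [ext] using hxM' (projIcc 0 1 zero_le_one t))
    (by rw [hx.zero, hx'.zero]; simp)
  have hb : 0 ≤ gronwallBound 0 (T.toNNReal * L : NNReal) ((‖F 0‖ + L * M) * |l - l'|) 1 := by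
    have := key 1 (by simp)
    rw [zero_add, sub_zero] at this
    exact dist_nonneg.trans this
  rw [ContinuousMap.dist_le hb]
  intro t
  have := key t t.2
  rw [zero_add, sub_zero, ext_coe, ext_coe] at this
  refine this.trans ?_
  apply gronwallBound_mono le_rfl (by positivity) (by positivity)
  exact t.2.2

theorem Good.unique [CompleteSpace E] (g : Good F FF) {l : ℝ} {x0 : E}
    {x x' : C(Icc (0:ℝ) 1, E)} (hx : IsSol F l x0 x) (hx' : IsSol F l x0 x') : x = x' := by
  obtain ⟨L, hL⟩ := g.lip (max ‖x‖ ‖x'‖)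
  have := g.dist_le hL (le_max_of_le_left (norm_nonneg x)) le_rfl hx hx'
    (fun t => (x.norm_coe_le_norm t).trans (le_max_left _ _))
    (fun t => (x'.norm_coe_le_norm t).trans (le_max_right _ _))
  rw [sub_self, abs_zero, mul_zero, gronwallBound_ε0_δ0] at this
  exact dist_le_zero.1 this

theorem gronwallBound_linear (K e x : ℝ) : gronwallBound 0 K e x = e * gronwallBound 0 K 1 x := by
  by_cases hK : K = 0
  · subst hK
    simp [gronwallBound_K0]
  · simp only [gronwallBound_of_K_ne_0 hK]
    ring

/-- Global existence from an a priori bound. -/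
theorem Good.global [CompleteSpace E] (g : Good F FF) (x0 : E)
    (hap : ∀ T : ℝ, ∃ M : ℝ, ∀ l : ℝ, |l| ≤ T → ∀ x, IsSol F l x0 x → ∀ t, ‖x t‖ ≤ M) :
    ∀ l : ℝ, ∃ x, IsSol F l x0 x := by
  set S : Set ℝ := {l | ∃ x, IsSol F l x0 x} with hS
  suffices h : S = univ by
    intro l
    have : l ∈ S := by rw [h]; trivial
    exact this
  have hopen : IsOpen S := by
    rw [isOpen_iff_mem_nhds]
    rintro l ⟨x, hx⟩
    obtain ⟨G, _, hG⟩ := g.local_flow l x0 x hx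
    have hc : ContinuousAt (fun l' : ℝ => (l', x0)) l := by fun_prop
    filter_upwards [hc.eventually hG] with l' hl'
    exact ⟨_, hl'⟩
  have hclosed : IsClosed S := by
    rw [← isSeqClosed_iff_isClosed]
    intro ls l hls hl
    choose xs hxs using hls
    obtain ⟨T, hT⟩ : ∃ T, ∀ n, |ls n| ≤ T := by
      obtain ⟨C, hC⟩ := hl.norm.bddAbove_range
      exact ⟨C, fun n => hC ⟨n, rfl⟩⟩
    obtain ⟨M, hM⟩ := hap T
    have hM0 : 0 ≤ M := (norm_nonneg _).trans (hM (ls 0) (hT 0) _ (hxs 0) ⟨0, by simp⟩)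
    obtain ⟨L, hL⟩ := g.lip M
    set C := (‖F 0‖ + L * M) * gronwallBound 0 (T.toNNReal * L : NNReal) 1 1 with hC
    have hd : ∀ n m, dist (xs n) (xs m) ≤ C * dist (ls n) (ls m) := by
      intro n m
      have := g.dist_le hL hM0 (hT n) (hxs n) (hxs m) (hM _ (hT n) _ (hxs n)) (hM _ (hT m) _ (hxs m))
      rw [gronwallBound_linear] at this
      rw [Real.dist_eq]
      refine this.trans (le_of_eq ?_)
      rw [hC]; ring
    have hcau : CauchySeq xs := by
      have h1 : CauchySeq ls := hl.cauchySeq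
      rw [cauchySeq_iff_tendsto_dist_atTop_0] at h1 ⊢
      have h2 := h1.const_mul C
      rw [mul_zero] at h2
      exact squeeze_zero (fun _ => dist_nonneg) (fun n => hd n.1 n.2) h2
    obtain ⟨x, hx⟩ := cauchySeq_tendsto_of_complete hcau
    refine ⟨x, ?_⟩
    rw [g.isSol_iff]
    have h1 : Tendsto (fun n => ContinuousLinearMap.const ℝ (Icc (0:ℝ) 1) x0
        + ls n • Jop (FF (xs n))) atTop (nhds (ContinuousLinearMap.const ℝ (Icc (0:ℝ) 1) x0
        + l • Jop (FF x))) := by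
      refine tendsto_const_nhds.add (hl.smul ?_)
      exact ((Jop.continuous.comp g.c.continuous).tendsto x).comp hx
    refine tendsto_nhds_unique hx (h1.congr fun n => ?_)
    exact ((g.isSol_iff _ _ _).1 (hxs n)).symm
  have hne : S.Nonempty := by
    refine ⟨0, ContinuousLinearMap.const ℝ (Icc (0:ℝ) 1) x0, ?_⟩
    intro t
    simp
  exact IsClopen.eq_univ ⟨hclosed, hopen⟩ hne

theorem Good.smooth_param [CompleteSpace E] (g : Good F FF) {V : Type*} [NormedAddCommGroup V]
    [NormedSpace ℝ V] {l : V → ℝ} {c : V → E} (hl : ContDiff ℝ (⊤ : ℕ∞) l)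
    (hc : ContDiff ℝ (⊤ : ℕ∞) c) {X : V → C(Icc (0:ℝ) 1, E)}
    (hX : ∀ v, IsSol F (l v) (c v) (X v)) : ContDiff ℝ (⊤ : ℕ∞) X := by
  rw [contDiff_iff_contDiffAt]
  intro v
  obtain ⟨G, hG, hGs⟩ := g.local_flow _ _ _ (hX v)
  have hp : ContDiff ℝ (⊤ : ℕ∞) (fun v => (l v, c v)) := hl.prodMk hc
  have h1 : ContDiffAt ℝ (⊤ : ℕ∞) (fun v => G (l v, c v)) v :=
    ContDiffAt.comp (g := G) (f := fun v => (l v, c v)) v hG hp.contDiffAt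
  refine h1.congr_of_eventuallyEq ?_
  have h2 := (hp.continuous.tendsto v).eventually hGs
  filter_upwards [h2] with w hw
  exact g.unique (hX w) hw

theorem IsSol.scale [CompleteSpace E] {l : ℝ} {x0 : E}
    {x : C(Icc (0:ℝ) 1, E)} (hx : IsSol F l x0 x) (r : Icc (0:ℝ) 1) :
    IsSol F (l * r) x0 ⟨fun t => ext x (r * t), (ext_continuous x).comp (by fun_prop)⟩ := by
  intro t
  have hmem : ∀ t : Icc (0:ℝ) 1, (r * t : ℝ) ∈ Icc (0:ℝ) 1 := fun t =>
    ⟨mul_nonneg r.2.1 t.2.1, mul_le_one₀ r.2.2 t.2.1 t.2.2⟩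
  simp only [ContinuousMap.coe_mk]
  rw [ext_of_mem _ (hmem t), hx, mul_smul]
  congr 2
  have h1 := intervalIntegral.smul_integral_comp_mul_left (a := 0) (b := (t:ℝ))
    (fun s => F (ext x s)) (r:ℝ)
  rw [mul_zero] at h1
  change ∫ s in (0:ℝ)..(r * t : ℝ), F (ext x s) = _
  rw [← h1]
  congr 1
  apply intervalIntegral.integral_congr
  intro s hs
  rw [uIcc_of_le t.2.1] at hs
  have hs' : s ∈ Icc (0:ℝ) 1 := ⟨hs.1, hs.2.trans t.2.2⟩
  simp only
  rw [ext_of_mem ⟨_, _⟩ hs']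
  rfl

theorem Good.flow_scale [CompleteSpace E] (g : Good F FF) {x0 : E} {X : ℝ → C(Icc (0:ℝ) 1, E)}
    (hX : ∀ l, IsSol F l x0 (X l)) (l : ℝ) (r : Icc (0:ℝ) 1) :
    X l r = X (l * r) ⟨1, by simp⟩ := by
  have := g.unique (hX (l * r)) ((hX l).scale r)
  rw [this]
  simp [ext_coe]

/-- The global solution as a curve on `ℝ`. -/
theorem Good.flow_deriv [CompleteSpace E] (g : Good F FF) {x0 : E} {X : ℝ → C(Icc (0:ℝ) 1, E)}
    (hX : ∀ l, IsSol F l x0 (X l)) (t : ℝ) :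
    HasDerivAt (fun l => X l ⟨1, by simp⟩) (F (X t ⟨1, by simp⟩)) t := by
  set z : ℝ → E := fun l => X l ⟨1, by simp⟩ with hz
  have hzc : Continuous z := by
    have := (g.smooth_param (l := fun l : ℝ => l) (c := fun _ => x0) contDiff_id
      contDiff_const hX).continuous
    exact (ContinuousMap.evalCLM ℝ (⟨1, by simp⟩ : Icc (0:ℝ) 1) :
      C(Icc (0:ℝ) 1, E) →L[ℝ] E).continuous.comp this
  have hFc : Continuous (fun s => F (z s)) := g.cF.continuous.comp hzc
  have hIntg : ∀ l, z l = x0 + ∫ s in (0:ℝ)..l, F (z s) := by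
    intro l
    have h1 := hX l ⟨1, by simp⟩
    rw [hz]
    simp only
    rw [h1]
    congr 1
    have h2 := intervalIntegral.smul_integral_comp_mul_left (a := 0) (b := (1:ℝ))
      (fun s => F (z s)) l
    rw [mul_zero, mul_one] at h2
    rw [← h2]
    congr 1
    apply intervalIntegral.integral_congr
    intro s hs
    rw [uIcc_of_le zero_le_one] at hs
    simp only
    rw [ext_of_mem _ hs, g.flow_scale hX l ⟨s, hs⟩]
  have h1 : HasDerivAt (fun l => x0 + ∫ s in (0:ℝ)..l, F (z s)) (F (z t)) t :=
    (intervalIntegral.integral_hasDerivAt_right (hFc.intervalIntegrable _ _)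
      (hFc.stronglyMeasurableAtFilter _ _) hFc.continuousAt).const_add x0
  have h2 : z = fun l => x0 + ∫ s in (0:ℝ)..l, F (z s) := funext hIntg
  rw [← h2] at h1
  exact h1

end Abstract
end TCH

namespace TCH

/-! ### The concrete vector field -/

section generic

variable {R S : Type*} [NormedCommRing R] [NormedAlgebra ℝ R] [NormedCommRing S] [NormedAlgebra ℝ S]

noncomputable def cK : ℝ := 1 / (4 * Real.sinh (1/2))

noncomputable def vff (x : Fin 7 → R) : R := (1/2 : ℝ) • (x 3 * x 3 * x 4 + x 6)

noncomputable def vP (kp km : R → R) (x : Fin 7 → R) : R :=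
  cK • (x 1 * kp (x 2 * vff x) + x 2 * km (x 1 * vff x))

noncomputable def vQ (kp km : R → R) (x : Fin 7 → R) : R :=
  cK • (x 1 * kp (x 2 * vff x) - x 2 * km (x 1 * vff x))

noncomputable def vf (kp km : R → R) (x : Fin 7 → R) : Fin 7 → R :=
  ![x 3, x 3 * x 1, -(x 3 * x 2), - vQ kp km x, x 5,
    (1/2 : ℝ) • x 6 + ((1/2 : ℝ) • (x 3 * x 3) - vP kp km x) * x 4,
    -((2:ℝ) • (vQ kp km x * x 3 * x 4)) + ((3:ℝ) • (x 3 * x 3) - (2:ℝ) • vP kp km x) * x 5]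

theorem vff_map (φ : R →ₐ[ℝ] S) (x : Fin 7 → R) : vff (fun i => φ (x i)) = φ (vff x) := by
  simp [vff]

theorem vP_map (φ : R →ₐ[ℝ] S) {kp km : R → R} {kp' km' : S → S}
    (hp : ∀ r, φ (kp r) = kp' (φ r)) (hm : ∀ r, φ (km r) = km' (φ r)) (x : Fin 7 → R) :
    vP kp' km' (fun i => φ (x i)) = φ (vP kp km x) := by
  simp [vP, vff_map, hp, hm]

theorem vQ_map (φ : R →ₐ[ℝ] S) {kp km : R → R} {kp' km' : S → S}
    (hp : ∀ r, φ (kp r) = kp' (φ r)) (hm : ∀ r, φ (km r) = km' (φ r)) (x : Fin 7 → R) :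
    vQ kp' km' (fun i => φ (x i)) = φ (vQ kp km x) := by
  simp [vQ, vff_map, hp, hm]

theorem vf_map (φ : R →ₐ[ℝ] S) {kp km : R → R} {kp' km' : S → S}
    (hp : ∀ r, φ (kp r) = kp' (φ r)) (hm : ∀ r, φ (km r) = km' (φ r)) (x : Fin 7 → R) (i : Fin 7) :
    vf kp' km' (fun i => φ (x i)) i = φ (vf kp km x i) := by
  fin_cases i <;> simp [vf, vP_map φ hp hm, vQ_map φ hp hm]

theorem vf_contDiff (kp km : R →L[ℝ] R) : ContDiff ℝ (⊤ : ℕ∞) (vf (kp : R → R) km) := by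
  rw [contDiff_pi]
  have h (j : Fin 7) : ContDiff ℝ (⊤ : ℕ∞) (fun x : Fin 7 → R => x j) := contDiff_apply ℝ R j
  have hf : ContDiff ℝ (⊤ : ℕ∞) (fun x : Fin 7 → R => vff x) :=
    ((((h 3).mul (h 3)).mul (h 4)).add (h 6)).const_smul _
  have h1 : ContDiff ℝ (⊤ : ℕ∞) (fun x : Fin 7 → R => x 1 * kp (x 2 * vff x)) :=
    (h 1).mul (kp.contDiff.comp ((h 2).mul hf))
  have h2 : ContDiff ℝ (⊤ : ℕ∞) (fun x : Fin 7 → R => x 2 * km (x 1 * vff x)) :=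
    (h 2).mul (km.contDiff.comp ((h 1).mul hf))
  have hP : ContDiff ℝ (⊤ : ℕ∞) (fun x : Fin 7 → R => vP (kp : R → R) km x) :=
    (h1.add h2).const_smul _
  have hQ : ContDiff ℝ (⊤ : ℕ∞) (fun x : Fin 7 → R => vQ (kp : R → R) km x) :=
    (h1.sub h2).const_smul _
  intro i
  fin_cases i
  · exact h 3
  · exact (h 3).mul (h 1)
  · exact ((h 3).mul (h 2)).neg
  · exact hQ.neg
  · exact h 5
  · exact ((h 6).const_smul _).add (((((h 3).mul (h 3)).const_smul _).sub hP).mul (h 4))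
  · exact ((((hQ.mul (h 3)).mul (h 4)).const_smul _).neg).add
      (((((h 3).mul (h 3)).const_smul _).sub (hP.const_smul _)).mul (h 5))

/-- Lipschitz and bounded on bounded sets. -/
def LB {E G : Type*} [NormedAddCommGroup E] [NormedAddCommGroup G] (f : E → G) : Prop :=
  ∀ r : ℝ, ∃ L M : ℝ, 0 ≤ L ∧ 0 ≤ M ∧ ∀ x y, ‖x‖ ≤ r → ‖y‖ ≤ r → ‖f x‖ ≤ M ∧ ‖f x - f y‖ ≤ L * ‖x - y‖

section LB
variable {E : Type*} [NormedAddCommGroup E] {f g : E → R}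

theorem LB.add (hf : LB f) (hg : LB g) : LB (fun x => f x + g x) := by
  intro r
  obtain ⟨L, M, hL, hM, h⟩ := hf r
  obtain ⟨L', M', hL', hM', h'⟩ := hg r
  refine ⟨L + L', M + M', by positivity, by positivity, fun x y hx hy => ⟨?_, ?_⟩⟩
  · exact (norm_add_le _ _).trans (add_le_add (h x y hx hy).1 (h' x y hx hy).1)
  · have : f x + g x - (f y + g y) = (f x - f y) + (g x - g y) := by abel
    rw [this, add_mul]
    exact (norm_add_le _ _).trans (add_le_add (h x y hx hy).2 (h' x y hx hy).2)

theorem LB.mul (hf : LB f) (hg : LB g) : LB (fun x => f x * g x) := by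
  intro r
  obtain ⟨L, M, hL, hM, h⟩ := hf r
  obtain ⟨L', M', hL', hM', h'⟩ := hg r
  refine ⟨L * M' + M * L', M * M', by positivity, by positivity, fun x y hx hy => ⟨?_, ?_⟩⟩
  · exact (norm_mul_le _ _).trans (mul_le_mul (h x y hx hy).1 (h' x y hx hy).1 (norm_nonneg _) hM)
  · have : f x * g x - f y * g y = (f x - f y) * g x + f y * (g x - g y) := by ring
    rw [this]
    refine (norm_add_le _ _).trans ?_
    have h1 : ‖(f x - f y) * g x‖ ≤ (L * ‖x - y‖) * M' := (norm_mul_le _ _).trans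
      (mul_le_mul (h x y hx hy).2 (h' x y hx hy).1 (norm_nonneg _) (by positivity))
    have h2 : ‖f y * (g x - g y)‖ ≤ M * (L' * ‖x - y‖) := (norm_mul_le _ _).trans
      (mul_le_mul (h y x hy hx).1 (h' x y hx hy).2 (norm_nonneg _) (by positivity))
    linarith

theorem LB.clm (T : R →L[ℝ] R) (hf : LB f) : LB (fun x => T (f x)) := by
  intro r
  obtain ⟨L, M, hL, hM, h⟩ := hf r
  refine ⟨‖T‖ * L, ‖T‖ * M, by positivity, by positivity, fun x y hx hy => ⟨?_, ?_⟩⟩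
  · exact (T.le_opNorm _).trans (by gcongr; exact (h x y hx hy).1)
  · rw [← map_sub, mul_assoc]
    exact (T.le_opNorm _).trans (by gcongr; exact (h x y hx hy).2)

theorem LB.smul (c : ℝ) (hf : LB f) : LB (fun x => c • f x) := by
  simpa using hf.clm (c • ContinuousLinearMap.id ℝ R)

theorem LB.neg (hf : LB f) : LB (fun x => - f x) := by
  simpa using hf.smul (-1)

theorem LB.sub (hf : LB f) (hg : LB g) : LB (fun x => f x - g x) := by
  simpa [sub_eq_add_neg] using hf.add hg.neg

end LB

theorem LB.proj (j : Fin 7) : LB (fun x : Fin 7 → R => x j) := by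
  intro r
  refine ⟨1, |r|, by positivity, by positivity, fun x y hx hy => ⟨?_, ?_⟩⟩
  · exact ((norm_le_pi_norm x j).trans hx).trans (le_abs_self _)
  · rw [one_mul]; exact norm_le_pi_norm (x - y) j

theorem vf_LB (kp km : R →L[ℝ] R) (i : Fin 7) : LB (fun x : Fin 7 → R => vf (kp : R → R) km x i) := by
  have h (j : Fin 7) : LB (fun x : Fin 7 → R => x j) := LB.proj j
  have hf : LB (fun x : Fin 7 → R => vff x) :=
    ((((h 3).mul (h 3)).mul (h 4)).add (h 6)).smul _
  have h1 : LB (fun x : Fin 7 → R => x 1 * kp (x 2 * vff x)) :=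
    (h 1).mul (LB.clm kp ((h 2).mul hf))
  have h2 : LB (fun x : Fin 7 → R => x 2 * km (x 1 * vff x)) :=
    (h 2).mul (LB.clm km ((h 1).mul hf))
  have hP : LB (fun x : Fin 7 → R => vP (kp : R → R) km x) := (h1.add h2).smul _
  have hQ : LB (fun x : Fin 7 → R => vQ (kp : R → R) km x) := (h1.sub h2).smul _
  fin_cases i
  · exact h 3
  · exact (h 3).mul (h 1)
  · exact ((h 3).mul (h 2)).neg
  · exact hQ.neg
  · exact h 5
  · exact ((h 6).smul _).add (((((h 3).mul (h 3)).smul _).sub hP).mul (h 4))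
  · exact ((((hQ.mul (h 3)).mul (h 4)).smul _).neg).add
      (((((h 3).mul (h 3)).smul _).sub (hP.smul _)).mul (h 5))

theorem vf_lip (kp km : R →L[ℝ] R) (r : ℝ) :
    ∃ L : NNReal, LipschitzOnWith L (vf (kp : R → R) km) (Metric.closedBall 0 r) := by
  choose L M hL hM h using fun i => vf_LB kp km i r
  refine ⟨∑ i, (L i).toNNReal, ?_⟩
  rw [lipschitzOnWith_iff_dist_le_mul]
  intro x hx y hy
  rw [mem_closedBall_zero_iff] at hx hy
  rw [dist_eq_norm, dist_eq_norm, pi_norm_le_iff_of_nonneg (by positivity)]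
  intro i
  refine ((h i x y hx hy).2).trans ?_
  gcongr
  have : ((L i).toNNReal : ℝ) ≤ ∑ i, (L i).toNNReal := by
    exact_mod_cast Finset.single_le_sum (f := fun i => (L i).toNNReal) (fun _ _ => zero_le) (Finset.mem_univ i)
  rwa [Real.coe_toNNReal _ (hL i)] at this

end generic

/-! ### The Banach space of bounded continuous functions, and the nonlocal operators -/

abbrev B := BoundedContinuousFunction ℝ ℝ
abbrev EE := Fin 7 → B
abbrev XX := C(Icc (0:ℝ) 1, EE)

theorem KopFun_bound (σ : ℝ) (g : B) (ξ : ℝ) :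
    ‖∫ θ in (0:ℝ)..1, Real.exp (σ * (θ - 1/2)) * g (ξ - θ)‖ ≤ Real.exp |σ| * ‖g‖ := by
  refine (intervalIntegral.norm_integral_le_of_norm_le_const
    (C := Real.exp |σ| * ‖g‖) ?_).trans (by simp)
  intro θ hθ
  rw [uIoc_of_le zero_le_one] at hθ
  rw [norm_mul]
  gcongr
  · rw [Real.norm_of_nonneg (Real.exp_pos _).le]
    apply Real.exp_le_exp.2
    refine (le_abs_self _).trans ?_
    rw [abs_mul]
    refine mul_le_of_le_one_right (abs_nonneg _) ?_
    rw [abs_le]; constructor <;> linarith [hθ.1, hθ.2]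
  · exact g.norm_coe_le_norm _

noncomputable def KopFun (σ : ℝ) (g : B) : B :=
  BoundedContinuousFunction.ofNormedAddCommGroup
    (fun ξ => ∫ θ in (0:ℝ)..1, Real.exp (σ * (θ - 1/2)) * g (ξ - θ))
    (intervalIntegral.continuous_parametric_intervalIntegral_of_continuous' (by fun_prop) _ _)
    (Real.exp |σ| * ‖g‖) (KopFun_bound σ g)

theorem KopFun_apply (σ : ℝ) (g : B) (ξ : ℝ) :
  KopFun σ g ξ = ∫ θ in (0:ℝ)..1, Real.exp (σ * (θ - 1/2)) * g (ξ - θ) := rfl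

noncomputable def Kop (σ : ℝ) : B →L[ℝ] B :=
  LinearMap.mkContinuous
    { toFun := KopFun σ
      map_add' := by
        intro f g
        ext ξ
        simp only [KopFun_apply, BoundedContinuousFunction.coe_add, Pi.add_apply, mul_add]
        apply intervalIntegral.integral_add <;>
        exact Continuous.intervalIntegrable (by fun_prop) _ _
      map_smul' := by
        intro c f
        ext ξ
        simp only [KopFun_apply, BoundedContinuousFunction.coe_smul, smul_eq_mul,
          RingHom.id_apply]
        rw [← intervalIntegral.integral_const_mul]
        congr 1; ext; ring }
    (Real.exp |σ|) (by
      intro g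
      exact BoundedContinuousFunction.norm_ofNormedAddCommGroup_le _ (by positivity) (KopFun_bound σ g))

theorem Kop_apply (σ : ℝ) (g : B) (ξ : ℝ) :
  Kop σ g ξ = ∫ θ in (0:ℝ)..1, Real.exp (σ * (θ - 1/2)) * g (ξ - θ) := rfl

/-- translation -/
noncomputable def tau (s : ℝ) : B →ₐ[ℝ] B where
  toFun g := g.compContinuous ⟨fun ξ => ξ + s, by fun_prop⟩
  map_one' := by ext; simp
  map_mul' := by intros; ext; simp
  map_zero' := by ext; simp
  map_add' := by intros; ext; simp
  commutes' := by intros; ext; simp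

@[simp] theorem tau_apply (s : ℝ) (g : B) (ξ : ℝ) : tau s g ξ = g (ξ + s) := rfl

theorem tau_norm_le (s : ℝ) (g : B) : ‖tau s g‖ ≤ ‖g‖ := by
  rw [BoundedContinuousFunction.norm_le (norm_nonneg _)]
  intro x; exact g.norm_coe_le_norm _

noncomputable def tauL (s : ℝ) : B →L[ℝ] B :=
  LinearMap.mkContinuous (tau s).toLinearMap 1 (by intro g; simpa using tau_norm_le s g)

@[simp] theorem tauL_apply (s : ℝ) (g : B) : tauL s g = tau s g := rfl

theorem tau_Kop (s σ : ℝ) (g : B) : tau s (Kop σ g) = Kop σ (tau s g) := by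
  ext ξ
  rw [tau_apply, Kop_apply, Kop_apply]
  congr 1; ext θ; rw [tau_apply]; congr 2; ring

noncomputable def F : EE → EE := vf (Kop 1) (Kop (-1))

noncomputable def coordC (j : Fin 7) : XX →L[ℝ] C(Icc (0:ℝ) 1, B) :=
  ContinuousLinearMap.compLeftContinuous ℝ (Icc (0:ℝ) 1) (ContinuousLinearMap.proj (R := ℝ) (φ := fun _ : Fin 7 => B) j)

noncomputable def unC (j : Fin 7) : C(Icc (0:ℝ) 1, B) →L[ℝ] XX :=
  ContinuousLinearMap.compLeftContinuous ℝ (Icc (0:ℝ) 1) (ContinuousLinearMap.single ℝ (fun _ : Fin 7 => B) j)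

noncomputable def KC (σ : ℝ) : C(Icc (0:ℝ) 1, B) →L[ℝ] C(Icc (0:ℝ) 1, B) :=
  ContinuousLinearMap.compLeftContinuous ℝ (Icc (0:ℝ) 1) (Kop σ)

noncomputable def FF (x : XX) : XX :=
  ∑ i, unC i (vf (KC 1) (KC (-1)) (fun j => coordC j x) i)

noncomputable def ev (t : Icc (0:ℝ) 1) : C(Icc (0:ℝ) 1, B) →ₐ[ℝ] B := ContinuousMap.evalAlgHom ℝ B t

theorem FF_apply (x : XX) (t : Icc (0:ℝ) 1) : FF x t = F (x t) := by
  have h : ∀ i, vf (Kop 1) (Kop (-1)) (x t) i = (vf (KC 1) (KC (-1)) (fun j => coordC j x) i) t := by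
    intro i
    have := vf_map (ev t) (kp := KC 1) (km := KC (-1)) (kp' := Kop 1) (km' := Kop (-1))
      (fun r => rfl) (fun r => rfl) (fun j => coordC j x) i
    exact this
  ext i : 1
  rw [FF, F, h i, ContinuousMap.sum_apply, Finset.sum_apply, Finset.sum_eq_single i]
  · change (Pi.single i _ : EE) i = _
    simp
  · intro j _ hj
    change (Pi.single j _ : EE) i = _
    simp [hj.symm]
  · simp

theorem FF_contDiff : ContDiff ℝ (⊤ : ℕ∞) FF := by
  unfold FF
  apply ContDiff.sum
  intro i _
  have h1 := vf_contDiff (R := C(Icc (0:ℝ) 1, B)) (KC 1) (KC (-1))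
  have h2 : ContDiff ℝ (⊤ : ℕ∞) (fun x : XX => fun j => coordC j x) := by
    rw [contDiff_pi]; intro j; exact ContinuousLinearMap.contDiff (𝕜 := ℝ) (E := XX) (F := C(Icc (0:ℝ) 1, B)) (coordC j)
  have h3 := ContinuousLinearMap.contDiff (𝕜 := ℝ) (E := C(Icc (0:ℝ) 1, B)) (F := XX) (unC i) (n := (⊤ : ℕ∞))
  exact h3.comp ((contDiff_pi.1 (h1.comp h2)) i)

theorem good : Good F FF where
  h := FF_apply
  c := FF_contDiff
  lip := vf_lip _ _

noncomputable def Tau (s : ℝ) : EE →L[ℝ] EE :=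
  ContinuousLinearMap.pi (fun i => (tauL s).comp (ContinuousLinearMap.proj (R := ℝ) (φ := fun _ : Fin 7 => B) i))

@[simp] theorem Tau_apply (s : ℝ) (x : EE) (i : Fin 7) : Tau s x i = tau s (x i) := rfl

theorem F_Tau (s : ℝ) (x : EE) : F (Tau s x) = Tau s (F x) := by
  ext i : 1
  exact vf_map (tau s) (tau_Kop s _) (tau_Kop s _) x i

noncomputable def TauC (s : ℝ) : XX →L[ℝ] XX :=
  ContinuousLinearMap.compLeftContinuous ℝ (Icc (0:ℝ) 1) (Tau s)

@[simp] theorem TauC_apply (s : ℝ) (x : XX) (t : Icc (0:ℝ) 1) : TauC s x t = Tau s (x t) := rfl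

theorem isSol_Tau {l : ℝ} {x0 : EE} {x : XX} (h : IsSol F l x0 x) (s : ℝ) :
    IsSol F l (Tau s x0) (TauC s x) := by
  intro t
  rw [TauC_apply, h t, map_add, map_smul]
  congr 2
  rw [← ContinuousLinearMap.intervalIntegral_comp_comm]
  · congr 1; ext r : 1
    rw [← F_Tau]; rfl
  · exact ((good.cF.continuous).comp (ext_continuous x)).intervalIntegrable _ _

end TCH

namespace TCH

/-! ### Smooth periodic functions and translations -/

theorem per_bounded {f : ℝ → ℝ} (hc : Continuous f) (hp : ∀ x, f (x + 1) = f x) :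
    ∃ C, ∀ x, ‖f x‖ ≤ C := by
  have : Bornology.IsBounded (range f) :=
    Function.Periodic.isBounded_of_continuous (c := 1) hp one_ne_zero hc
  obtain ⟨C, hC⟩ := this.exists_norm_le
  exact ⟨C, fun x => hC _ ⟨x, rfl⟩⟩

noncomputable def pb (f : ℝ → ℝ) (hc : Continuous f) (hp : ∀ x, f (x + 1) = f x) : B :=
  BoundedContinuousFunction.ofNormedAddCommGroup f hc _ (per_bounded hc hp).choose_spec

@[simp] theorem pb_apply (f : ℝ → ℝ) (hc : Continuous f) (hp : ∀ x, f (x + 1) = f x) (x : ℝ) :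
  pb f hc hp x = f x := rfl

theorem per_deriv {f : ℝ → ℝ} (hp : ∀ x, f (x + 1) = f x) (x : ℝ) : deriv f (x + 1) = deriv f x := by
  rw [← deriv_comp_add_const]
  congr 1; ext y; exact hp y

theorem tau_hasDerivAt {f : ℝ → ℝ} (hf : ContDiff ℝ (⊤ : ℕ∞) f) (hp : ∀ x, f (x + 1) = f x)
    (hd : Continuous (deriv f)) (s : ℝ) :
    HasDerivAt (fun s => tau s (pb f hf.continuous hp)) (tau s (pb (deriv f) hd (per_deriv hp))) s := by
  have hf' : ContDiff ℝ (⊤ : ℕ∞) (deriv f) := ((contDiff_infty_iff_deriv).1 hf).2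
  have hf'' : ContDiff ℝ (⊤ : ℕ∞) (deriv (deriv f)) := ((contDiff_infty_iff_deriv).1 hf').2
  obtain ⟨C, hC⟩ := per_bounded hf''.continuous (per_deriv (per_deriv hp))
  have hC0 : 0 ≤ C := (norm_nonneg _).trans (hC 0)
  have hdf (x : ℝ) : HasDerivAt f (deriv f x) x := (hf.differentiable (by simp) x).hasDerivAt
  have lip (x y : ℝ) : ‖deriv f y - deriv f x‖ ≤ C * ‖y - x‖ :=
    convex_univ.norm_image_sub_le_of_norm_deriv_le
      (fun z _ => hf'.differentiable (by simp) z) (fun z _ => hC z) (mem_univ _) (mem_univ _)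
  have key (x h : ℝ) : ‖f (x + h) - f x - h * deriv f x‖ ≤ C * ‖h‖ * ‖h‖ := by
    have := (convex_uIcc 0 h).norm_image_sub_le_of_norm_hasDerivWithin_le
      (f := fun r => f (x + r) - r * deriv f x) (f' := fun r => deriv f (x + r) - deriv f x)
      (C := C * ‖h‖) (x := 0) (y := h) ?_ ?_ left_mem_uIcc right_mem_uIcc
    · simp only [sub_zero, add_zero, zero_mul] at this
      have e : f (x + h) - f x - h * deriv f x = f (x + h) - h * deriv f x - f x := by ring
      rw [e]; exact this
    · intro r _
      have h1 : HasDerivAt (fun r => f (x + r)) (deriv f (x + r)) r := by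
        simpa using (hdf (x + r)).comp_const_add x r
      have h2 : HasDerivAt (fun r => r * deriv f x) (deriv f x) r := by
        simpa using (hasDerivAt_id r).mul_const (deriv f x)
      exact (h1.sub h2).hasDerivWithinAt
    · intro r hr
      refine (lip _ _).trans ?_
      gcongr
      simp only [add_sub_cancel_left, Real.norm_eq_abs]
      simpa using abs_sub_left_of_mem_uIcc hr
  rw [hasDerivAt_iff_isLittleO_nhds_zero]
  apply Asymptotics.IsBigO.trans_isLittleO (g := fun h : ℝ => h * h)
  · apply Asymptotics.IsBigO.of_bound C
    filter_upwards with h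
    rw [norm_mul, ← mul_assoc, BoundedContinuousFunction.norm_le (by positivity)]
    intro x
    have := key (x + s) h
    simpa [← add_assoc] using this
  · have h1 : (fun h : ℝ => h) =o[nhds 0] (fun _ : ℝ => (1:ℝ)) := by
      rw [Asymptotics.isLittleO_one_iff]; exact tendsto_id
    simpa using h1.mul_isBigO (Asymptotics.isBigO_refl (fun h : ℝ => h) (nhds 0))

theorem tau_contDiff {f : ℝ → ℝ} (hf : ContDiff ℝ (⊤ : ℕ∞) f) (hp : ∀ x, f (x + 1) = f x) :
    ContDiff ℝ (⊤ : ℕ∞) (fun s => tau s (pb f hf.continuous hp)) := by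
  rw [contDiff_infty]
  intro n
  induction n generalizing f with
  | zero =>
    have hd : Continuous (deriv f) := ((contDiff_infty_iff_deriv).1 hf).2.continuous
    exact contDiff_zero.2 (continuous_iff_continuousAt.2 fun s => (tau_hasDerivAt hf hp hd s).continuousAt)
  | succ n ih =>
    have hf' : ContDiff ℝ (⊤ : ℕ∞) (deriv f) := ((contDiff_infty_iff_deriv).1 hf).2
    have h := fun s => tau_hasDerivAt hf hp hf'.continuous s
    push_cast
    rw [contDiff_succ_iff_deriv]
    refine ⟨fun s => (h s).differentiableAt, by simp, ?_⟩
    rw [deriv_eq h]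
    exact ih hf' (per_deriv hp)

noncomputable def evE (i : Fin 7) (ξ : ℝ) : EE →L[ℝ] ℝ :=
  (BoundedContinuousFunction.evalCLM ℝ ξ).comp (ContinuousLinearMap.proj (R := ℝ) (φ := fun _ : Fin 7 => B) i)

@[simp] theorem evE_apply (i : Fin 7) (ξ : ℝ) (z : EE) : evE i ξ z = z i ξ := rfl

theorem hasDerivAt_of_Tau {y D : EE} (h : HasDerivAt (fun s => Tau s y) D 0) (i : Fin 7) (ξ : ℝ) :
    HasDerivAt (y i) (D i ξ) ξ := by
  have h1 : HasDerivAt (fun s => evE i ξ (Tau s y)) (evE i ξ D) 0 :=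
    (evE i ξ).hasFDerivAt.comp_hasDerivAt 0 h
  have h2 : HasDerivAt (fun s => y i (ξ + s)) (D i ξ) (ξ - ξ) := by simpa using h1
  have h3 := h2.comp_sub_const ξ ξ
  simpa using h3

theorem ev_hasDeriv {t : ℝ} {x : ℝ → EE} {D : EE} {s : Set ℝ} (h : HasDerivWithinAt x D s t)
    (i : Fin 7) (ξ : ℝ) : HasDerivWithinAt (fun r => x r i ξ) (D i ξ) s t :=
  (evE i ξ).hasFDerivAt.comp_hasDerivWithinAt t h

noncomputable def evX (t : Icc (0:ℝ) 1) : XX →L[ℝ] EE := ContinuousMap.evalCLM ℝ t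

theorem regularity {l : ℝ} {x0 : EE} {x : XX} (hx : IsSol F l x0 x)
    (h0 : ContDiff ℝ (⊤ : ℕ∞) (fun s => Tau s x0)) :
    ∃ D Φ : XX, (∀ t i ξ, HasDerivAt (x t i) (D t i ξ) ξ) ∧
      (∀ t i ξ, HasDerivAt (F (x t) i) (Φ t i ξ) ξ) ∧
      ∀ t ∈ Icc (0:ℝ) 1, HasDerivWithinAt (ext D) (l • ext Φ t) (Icc 0 1) t := by
  have hG : ContDiff ℝ (⊤ : ℕ∞) (fun s => TauC s x) :=
    good.smooth_param (V := ℝ) (l := fun _ => l) (c := fun s => Tau s x0) contDiff_const h0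
      (fun s => isSol_Tau hx s)
  have hFG : ContDiff ℝ (⊤ : ℕ∞) (fun s => FF (TauC s x)) := good.c.comp hG
  have hD := (hG.differentiable (by simp) 0).hasDerivAt
  have hΦ := (hFG.differentiable (by simp) 0).hasDerivAt
  have hd0 := (h0.differentiable (by simp) 0).hasDerivAt
  set D := deriv (fun s => TauC s x) 0 with hDdef
  set Φ := deriv (fun s => FF (TauC s x)) 0 with hΦdef
  have eqn : D = ContinuousLinearMap.const ℝ (Icc (0:ℝ) 1) (deriv (fun s => Tau s x0) 0) + l • Jop Φ := by
    have h1 : HasDerivAt (fun s => ContinuousLinearMap.const ℝ (Icc (0:ℝ) 1) (Tau s x0) + l • Jop (FF (TauC s x)))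
       (ContinuousLinearMap.const ℝ (Icc (0:ℝ) 1) (deriv (fun s => Tau s x0) 0) + l • Jop Φ) 0 := by
      have e1 : HasDerivAt (fun s => (ContinuousLinearMap.const ℝ (Icc (0:ℝ) 1) (Tau s x0) : XX))
          (ContinuousLinearMap.const ℝ (Icc (0:ℝ) 1) (deriv (fun s => Tau s x0) 0)) 0 :=
        HasFDerivAt.comp_hasDerivAt (l := fun z : EE => (ContinuousLinearMap.const ℝ (Icc (0:ℝ) 1) z : XX)) 0
          (ContinuousLinearMap.hasFDerivAt (𝕜 := ℝ) (E := EE) (F := XX)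
          (ContinuousLinearMap.const ℝ (Icc (0:ℝ) 1))) hd0
      have e2 : HasDerivAt (fun s => (Jop (FF (TauC s x)) : XX)) (Jop Φ) 0 :=
        (ContinuousLinearMap.hasFDerivAt (𝕜 := ℝ) (E := XX) (F := XX) Jop).comp_hasDerivAt 0 hΦ
      have e3 : HasDerivAt (fun s => l • (Jop (FF (TauC s x)) : XX)) (l • Jop Φ) 0 := e2.const_smul l
      exact e1.add e3
    have h2 : (fun s => TauC s x) = (fun s => ContinuousLinearMap.const ℝ (Icc (0:ℝ) 1) (Tau s x0) + l • Jop (FF (TauC s x))) := by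
      ext1 s
      exact (good.isSol_iff _ _ _).1 (isSol_Tau hx s)
    rw [← h2] at h1
    exact hD.unique h1
  refine ⟨D, Φ, ?_, ?_, ?_⟩
  · intro t i ξ
    apply hasDerivAt_of_Tau
    exact (ContinuousLinearMap.hasFDerivAt (𝕜 := ℝ) (E := XX) (F := EE) (evX t)).comp_hasDerivAt 0 hD
  · intro t i ξ
    apply hasDerivAt_of_Tau
    have h1 : HasDerivAt (fun s => evX t (FF (TauC s x))) (evX t Φ) 0 :=
      (ContinuousLinearMap.hasFDerivAt (𝕜 := ℝ) (E := XX) (F := EE) (evX t)).comp_hasDerivAt 0 hΦ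
    have h2 : (fun s => evX t (FF (TauC s x))) = fun s => Tau s (F (x t)) := by
      ext1 s
      rw [← F_Tau]
      exact FF_apply _ _
    rw [h2] at h1
    exact h1
  · intro t ht
    have h1 : HasDerivWithinAt (fun t => deriv (fun s => Tau s x0) 0 + l • ∫ s in (0:ℝ)..t, ext Φ s)
        (l • ext Φ t) (Icc 0 1) t := by
      have e1 : HasDerivWithinAt (fun t => ∫ s in (0:ℝ)..t, ext Φ s) (ext Φ t) (Icc 0 1) t :=
        (intervalIntegral.integral_hasDerivAt_right ((ext_continuous Φ).intervalIntegrable _ _)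
        ((ext_continuous Φ).stronglyMeasurableAtFilter _ _) (ext_continuous Φ).continuousAt).hasDerivWithinAt
      have e2 : HasDerivWithinAt (fun t => l • ∫ s in (0:ℝ)..t, ext Φ s) (l • ext Φ t) (Icc 0 1) t :=
        e1.const_smul l
      exact e2.const_add _
    refine h1.congr (fun r hr => ?_) ?_
    · rw [ext_of_mem _ hr, eqn]; simp [Jop_apply]
    · rw [ext_of_mem _ ht, eqn]; simp [Jop_apply]

theorem joint_smooth {X : ℝ → XX} {x0 : EE} (hX : ∀ l, IsSol F l x0 (X l))
    (h0 : ContDiff ℝ (⊤ : ℕ∞) (fun s => Tau s x0)) (i : Fin 7) (t : Icc (0:ℝ) 1) :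
    ContDiff ℝ (⊤ : ℕ∞) (fun v : ℝ × ℝ => X v.1 t i v.2) := by
  have hG : ContDiff ℝ (⊤ : ℕ∞) (fun v : ℝ × ℝ => TauC v.2 (X v.1)) :=
    good.smooth_param (V := ℝ × ℝ) (l := fun v => v.1) (c := fun v => Tau v.2 x0) contDiff_fst
      (h0.comp contDiff_snd) (fun v => isSol_Tau (hX v.1) v.2)
  have h1 : ContDiff ℝ (⊤ : ℕ∞) (fun v : ℝ × ℝ => evX t (TauC v.2 (X v.1))) :=
    ContDiff.comp (g := fun z : XX => evX t z)
      (ContinuousLinearMap.contDiff (𝕜 := ℝ) (E := XX) (F := EE) (evX t) (n := (⊤ : ℕ∞))) hG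
  have h2 : ContDiff ℝ (⊤ : ℕ∞) (fun v : ℝ × ℝ => evE i 0 (evX t (TauC v.2 (X v.1)))) :=
    (evE i 0).contDiff.comp h1
  convert h2 using 2 with v
  change X v.1 t i v.2 = X v.1 t i (0 + v.2)
  rw [zero_add]

theorem sol_periodic {l : ℝ} {x0 : EE} {x : XX} (hx : IsSol F l x0 x) (h0 : Tau 1 x0 = x0)
    (t : Icc (0:ℝ) 1) (i : Fin 7) (ξ : ℝ) : x t i (ξ + 1) = x t i ξ := by
  have h := isSol_Tau hx 1
  rw [h0] at h
  have := good.unique h hx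
  conv_rhs => rw [← this]
  rfl

/-! ### scalar ODE helpers -/

theorem gron {f f' : ℝ → ℝ} {K T : ℝ} (hc : ContinuousOn f (Icc 0 T))
    (hd : ∀ r ∈ Ioo 0 T, HasDerivAt f (f' r) r) (hle : ∀ r ∈ Ioo 0 T, f' r ≤ K * f r) :
    ∀ r ∈ Icc 0 T, f r ≤ f 0 * Real.exp (K * r) := by
  have hE (r : ℝ) : HasDerivAt (fun r => Real.exp (-(K * r))) (Real.exp (-(K * r)) * (-K)) r := by
    have : HasDerivAt (fun r : ℝ => -(K * r)) (-K) r := by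
      simpa using (hasDerivAt_id r).const_mul (-K)
    exact this.exp
  have anti : AntitoneOn (fun r => f r * Real.exp (-(K * r))) (Icc 0 T) := by
    apply antitoneOn_of_hasDerivWithinAt_nonpos (convex_Icc 0 T)
      (f' := fun r => f' r * Real.exp (-(K * r)) + f r * (Real.exp (-(K * r)) * (-K)))
    · exact hc.mul (by fun_prop)
    · intro r hr
      rw [interior_Icc] at hr
      exact ((hd r hr).mul (hE r)).hasDerivWithinAt
    · intro r hr
      rw [interior_Icc] at hr
      have := mul_nonpos_of_nonpos_of_nonneg (sub_nonpos.2 (hle r hr)) (Real.exp_pos (-(K * r))).le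
      linarith
  intro r hr
  have h := anti (left_mem_Icc.2 (hr.1.trans hr.2)) hr hr.1
  simp only [mul_zero, neg_zero, Real.exp_zero, mul_one] at h
  have h2 := mul_le_mul_of_nonneg_right h (Real.exp_pos (K * r)).le
  rwa [mul_assoc, ← Real.exp_add, neg_add_cancel, Real.exp_zero, mul_one] at h2

theorem gron' {f f' : ℝ → ℝ} {K : ℝ}
    (hd : ∀ r ∈ Icc (0:ℝ) 1, HasDerivWithinAt f (f' r) (Icc 0 1) r)
    (hle : ∀ r ∈ Icc (0:ℝ) 1, f' r ≤ K * f r) :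
    ∀ r ∈ Icc (0:ℝ) 1, f r ≤ f 0 * Real.exp (K * r) :=
  gron (fun r hr => (hd r hr).continuousWithinAt)
    (fun r hr => (hd r (Ioo_subset_Icc_self hr)).hasDerivAt (Icc_mem_nhds hr.1 hr.2))
    (fun r hr => hle r (Ioo_subset_Icc_self hr))

theorem const_of {f : ℝ → ℝ} (hd : ∀ r ∈ Icc (0:ℝ) 1, HasDerivWithinAt f 0 (Icc 0 1) r) :
    ∀ r ∈ Icc (0:ℝ) 1, f r = f 0 := by
  intro r hr
  have h1 := gron' (K := 0) (f' := fun _ => 0) hd (by simp) r hr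
  have h2 := gron' (f := fun r => - f r) (K := 0) (f' := fun _ => 0)
    (fun r hr => by simpa using (hd r hr).fun_neg) (by simp) r hr
  simp at h1 h2
  linarith

end TCH

namespace TCH

noncomputable def PP (z : EE) : B := vP (Kop 1) (Kop (-1)) z
noncomputable def QQ (z : EE) : B := vQ (Kop 1) (Kop (-1)) z

theorem vff_pt (z : EE) (ξ : ℝ) : vff z ξ = 1/2 * (z 3 ξ * z 3 ξ * z 4 ξ + z 6 ξ) := by
  simp [vff]; ring

theorem PP_pt (z : EE) (ξ : ℝ) : PP z ξ =
    cK * (z 1 ξ * Kop 1 (z 2 * vff z) ξ + z 2 ξ * Kop (-1) (z 1 * vff z) ξ) := by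
  simp [PP, vP]; ring

theorem QQ_pt (z : EE) (ξ : ℝ) : QQ z ξ =
    cK * (z 1 ξ * Kop 1 (z 2 * vff z) ξ - z 2 ξ * Kop (-1) (z 1 * vff z) ξ) := by
  simp [QQ, vQ]

theorem F0 (z : EE) (ξ : ℝ) : F z 0 ξ = z 3 ξ := rfl
theorem F1 (z : EE) (ξ : ℝ) : F z 1 ξ = z 3 ξ * z 1 ξ := rfl
theorem F2 (z : EE) (ξ : ℝ) : F z 2 ξ = -(z 3 ξ * z 2 ξ) := rfl
theorem F3 (z : EE) (ξ : ℝ) : F z 3 ξ = - QQ z ξ := rfl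
theorem F4 (z : EE) (ξ : ℝ) : F z 4 ξ = z 5 ξ := rfl
theorem F5 (z : EE) (ξ : ℝ) : F z 5 ξ = 1/2 * z 6 ξ + (1/2 * (z 3 ξ * z 3 ξ) - PP z ξ) * z 4 ξ := by
  simp [F, vf, PP]
theorem F6 (z : EE) (ξ : ℝ) : F z 6 ξ =
    -(2 * (QQ z ξ * z 3 ξ * z 4 ξ)) + (3 * (z 3 ξ * z 3 ξ) - 2 * PP z ξ) * z 5 ξ := by
  simp [F, vf, PP, QQ]

theorem Kop_eq (σ : ℝ) (g : B) (ξ : ℝ) : Kop σ g ξ =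
    Real.exp (σ * (ξ - 1/2)) * ∫ η in (ξ - 1)..ξ, Real.exp (-(σ * η)) * g η := by
  rw [Kop_apply, ← intervalIntegral.integral_const_mul]
  have := intervalIntegral.integral_comp_sub_left (a := 0) (b := 1)
    (fun η => Real.exp (σ * (ξ - 1/2)) * (Real.exp (-(σ * η)) * g η)) ξ
  rw [sub_zero] at this
  rw [← this]
  congr 1; ext θ
  rw [← mul_assoc, ← Real.exp_add]
  congr 2; ring

theorem Kop_hasDerivAt (σ : ℝ) (g : B) (hp : ∀ ξ, g (ξ + 1) = g ξ) (ξ : ℝ) :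
    HasDerivAt (Kop σ g) (σ * Kop σ g ξ - 2 * Real.sinh (σ / 2) * g ξ) ξ := by
  have hc : Continuous (fun η => Real.exp (-(σ * η)) * g η) := by fun_prop
  have hA (x : ℝ) : HasDerivAt (fun x => ∫ η in (0:ℝ)..x, Real.exp (-(σ * η)) * g η)
      (Real.exp (-(σ * x)) * g x) x :=
    intervalIntegral.integral_hasDerivAt_right (hc.intervalIntegrable _ _)
      (hc.stronglyMeasurableAtFilter _ _) hc.continuousAt
  have h1 : HasDerivAt (fun x => ∫ η in (x - 1)..x, Real.exp (-(σ * η)) * g η)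
      (Real.exp (-(σ * ξ)) * g ξ - Real.exp (-(σ * (ξ - 1))) * g (ξ - 1)) ξ := by
    have h2 := (hA ξ).fun_sub ((hA (ξ - 1)).comp_sub_const ξ 1)
    refine h2.congr_of_eventuallyEq (Eventually.of_forall fun x => ?_)
    simp only
    rw [intervalIntegral.integral_interval_sub_left] <;> exact hc.intervalIntegrable _ _
  have h3 : HasDerivAt (fun x => Real.exp (σ * (x - 1/2))) (Real.exp (σ * (ξ - 1/2)) * σ) ξ := by
    have : HasDerivAt (fun x => σ * (x - 1/2)) σ ξ := by
      simpa only [id, mul_one] using ((hasDerivAt_id ξ).sub_const (1/2)).const_mul σ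
    exact this.exp
  have h4 := h3.fun_mul h1
  have h5 : (Kop σ g : ℝ → ℝ) = fun x => Real.exp (σ * (x - 1/2)) * ∫ η in (x - 1)..x, Real.exp (-(σ * η)) * g η := by
    ext x; exact Kop_eq σ g x
  have hp' : g (ξ - 1) = g ξ := by rw [← hp (ξ - 1)]; simp
  rw [Kop_eq]
  rw [← h5] at h4
  refine (h4).congr_deriv ?_
  rw [hp', Real.sinh_eq]
  have e1 : Real.exp (σ * (ξ - 1/2)) * Real.exp (-(σ * ξ)) = Real.exp (-(σ/2)) := by
    rw [← Real.exp_add]; congr 1; ring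
  have e2 : Real.exp (σ * (ξ - 1/2)) * Real.exp (-(σ * (ξ - 1))) = Real.exp (σ/2) := by
    rw [← Real.exp_add]; congr 1; ring
  linear_combination g ξ * e1 - g ξ * e2

theorem cK_sinh : cK * (4 * Real.sinh (1/2)) = 1 := by
  unfold cK
  have : 0 < Real.sinh (1/2) := by rw [Real.sinh_pos_iff]; norm_num
  field_simp

theorem cK_pos : 0 < cK := by
  unfold cK
  have : 0 < Real.sinh (1/2) := by rw [Real.sinh_pos_iff]; norm_num
  positivity

theorem PQ_hasDerivAt {z : EE} (hper : ∀ i ξ, z i (ξ + 1) = z i ξ)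
    (ha : ∀ ξ, z 1 ξ = Real.exp (z 0 ξ)) (hb : ∀ ξ, z 2 ξ = Real.exp (-z 0 ξ)) {ξ w' : ℝ}
    (hw : HasDerivAt (z 0) w' ξ) :
    HasDerivAt (PP z) (QQ z ξ * (1 + w')) ξ ∧ HasDerivAt (QQ z) (PP z ξ * (1 + w') - vff z ξ) ξ := by
  have h1 : HasDerivAt (z 1) (z 1 ξ * w') ξ := by
    rw [show (z 1 : ℝ → ℝ) = fun ξ => Real.exp (z 0 ξ) from funext ha]; exact hw.exp
  have h2 : HasDerivAt (z 2) (z 2 ξ * (-w')) ξ := by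
    rw [show (z 2 : ℝ → ℝ) = fun ξ => Real.exp (-z 0 ξ) from funext hb]; exact hw.fun_neg.exp
  have hfp : ∀ x, vff z (x + 1) = vff z x := by intro x; simp only [vff_pt, hper]
  have k1 := Kop_hasDerivAt 1 (z 2 * vff z) (by intro x; simp [hper, hfp]) ξ
  have k2 := Kop_hasDerivAt (-1) (z 1 * vff z) (by intro x; simp [hper, hfp]) ξ
  have hab : z 1 ξ * z 2 ξ = 1 := by rw [ha, hb, ← Real.exp_add]; simp
  have s1 : Real.sinh (-1/2) = - Real.sinh (1/2) := by rw [← Real.sinh_neg]; norm_num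
  rw [s1] at k2
  simp only [BoundedContinuousFunction.coe_mul, Pi.mul_apply] at k1 k2
  have hc := cK_sinh
  constructor
  · rw [show (PP z : ℝ → ℝ) = fun ξ => _ from funext (PP_pt z), QQ_pt]
    refine ((((h1.fun_mul k1).fun_add (h2.fun_mul k2)).const_mul cK)).congr_deriv ?_
    ring
  · rw [show (QQ z : ℝ → ℝ) = fun ξ => _ from funext (QQ_pt z), PP_pt]
    refine ((((h1.fun_mul k1).fun_sub (h2.fun_mul k2)).const_mul cK)).congr_deriv ?_
    linear_combination -(vff z ξ) * (cK * (4 * Real.sinh (1/2))) * hab - vff z ξ * hc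

/-- Invariants of the Lagrangian system. -/
structure Inv (h : ℝ) (r : ℝ → ℝ) (z : EE) : Prop where
  per : ∀ i ξ, z i (ξ + 1) = z i ξ
  a : ∀ ξ, z 1 ξ = Real.exp (z 0 ξ)
  b : ∀ ξ, z 2 ξ = Real.exp (-z 0 ξ)
  w' : ∀ ξ, HasDerivAt (z 0) (z 4 ξ - 1) ξ
  U' : ∀ ξ, HasDerivAt (z 3) (z 5 ξ) ξ
  inv : ∀ ξ, z 4 ξ * z 6 ξ - z 4 ξ ^ 2 * z 3 ξ ^ 2 - z 5 ξ ^ 2 = r ξ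
  p : ∀ ξ, 0 < z 4 ξ
  nu : ∫ ξ in (0:ℝ)..1, z 6 ξ = h

noncomputable def intB : B →L[ℝ] ℝ :=
  LinearMap.mkContinuous
    { toFun := fun g => ∫ ξ in (0:ℝ)..1, g ξ
      map_add' := by
        intro f g
        simp only [BoundedContinuousFunction.coe_add, Pi.add_apply]
        apply intervalIntegral.integral_add <;>
        exact Continuous.intervalIntegrable (by fun_prop) _ _
      map_smul' := by
        intro c f
        simp }
    1 (by
      intro g
      refine (intervalIntegral.norm_integral_le_of_norm_le_const
        (C := ‖g‖) fun x _ => g.norm_coe_le_norm x).trans (by simp))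

theorem intB_apply (g : B) : intB g = ∫ ξ in (0:ℝ)..1, g ξ := rfl

theorem PP_continuous : Continuous PP := by
  unfold PP vP vff
  fun_prop

theorem invariants {x0 : EE} {r : ℝ → ℝ} {h : ℝ} (h0 : Inv h r x0) (hr : ∀ ξ, 0 < r ξ)
    (h0p : ∀ ξ, x0 4 ξ = 1)
    (h0s : ContDiff ℝ (⊤ : ℕ∞) (fun s => Tau s x0)) {l : ℝ} {x : XX} (hx : IsSol F l x0 x)
    (t : Icc (0:ℝ) 1) : Inv h r (x t) := by
  obtain ⟨D, Φ, hD, hΦ, hDt⟩ := regularity hx h0s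
  have hper := sol_periodic hx (by ext i ξ; exact h0.per i ξ)
  have hxt := hx.hasDerivAt_aux good.cF.continuous
  have ez : ext x 0 = x0 := hx.zero
  have hxt' (i : Fin 7) (ξ : ℝ) (t : ℝ) (ht : t ∈ Icc (0:ℝ) 1) :
      HasDerivWithinAt (fun r => ext x r i ξ) (l * F (ext x t) i ξ) (Icc 0 1) t :=
    ev_hasDeriv (hxt t ht) i ξ
  have hDt' (i : Fin 7) (ξ : ℝ) (t : ℝ) (ht : t ∈ Icc (0:ℝ) 1) :
      HasDerivWithinAt (fun r => ext D r i ξ) (l * ext Φ t i ξ) (Icc 0 1) t :=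
    ev_hasDeriv (hDt t ht) i ξ
  have hperE (t : ℝ) (i : Fin 7) (ξ : ℝ) : ext x t i (ξ + 1) = ext x t i ξ := hper _ i ξ
  have hDE (t : ℝ) (i : Fin 7) (ξ : ℝ) : HasDerivAt (ext x t i) (ext D t i ξ) ξ := hD _ i ξ
  have hΦE (t : ℝ) (i : Fin 7) (ξ : ℝ) : HasDerivAt (F (ext x t) i) (ext Φ t i ξ) ξ := hΦ _ i ξ
  have haE : ∀ t ∈ Icc (0:ℝ) 1, ∀ ξ, ext x t 1 ξ = Real.exp (ext x t 0 ξ) := by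
    intro t ht ξ
    have := const_of (f := fun s => ext x s 1 ξ * Real.exp (- ext x s 0 ξ)) (fun s hs => by
      refine ((hxt' 1 ξ s hs).fun_mul ((hxt' 0 ξ s hs).fun_neg.exp)).congr_deriv ?_
      rw [F0, F1]; ring) t ht
    simp only [ez, h0.a] at this
    rw [← Real.exp_add, add_neg_cancel, Real.exp_zero, Real.exp_neg] at this
    field_simp at this
    exact this
  have hbE : ∀ t ∈ Icc (0:ℝ) 1, ∀ ξ, ext x t 2 ξ = Real.exp (-ext x t 0 ξ) := by
    intro t ht ξ
    have := const_of (f := fun s => ext x s 2 ξ * Real.exp (ext x s 0 ξ)) (fun s hs => by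
      refine ((hxt' 2 ξ s hs).fun_mul ((hxt' 0 ξ s hs).exp)).congr_deriv ?_
      rw [F0, F2]; ring) t ht
    simp only [ez, h0.b] at this
    rw [← Real.exp_add, neg_add_cancel, Real.exp_zero] at this
    rw [Real.exp_neg]
    field_simp
    exact this
  have hPQ : ∀ t ∈ Icc (0:ℝ) 1, ∀ ξ, HasDerivAt (PP (ext x t)) (QQ (ext x t) ξ * (1 + ext D t 0 ξ)) ξ ∧
      HasDerivAt (QQ (ext x t)) (PP (ext x t) ξ * (1 + ext D t 0 ξ) - vff (ext x t) ξ) ξ :=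
    fun t ht ξ => PQ_hasDerivAt (hperE t) (haE t ht) (hbE t ht) (hDE t 0 ξ)
  have hΦ0 : ∀ t ∈ Icc (0:ℝ) 1, ∀ ξ, ext Φ t 0 ξ = ext D t 3 ξ :=
    fun t ht ξ => (hΦE t 0 ξ).unique (hDE t 3 ξ)
  have hΦ3 : ∀ t ∈ Icc (0:ℝ) 1, ∀ ξ, ext Φ t 3 ξ = -(PP (ext x t) ξ * (1 + ext D t 0 ξ) - vff (ext x t) ξ) :=
    fun t ht ξ => (hΦE t 3 ξ).unique ((hPQ t ht ξ).2.neg)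
  obtain ⟨M, hM⟩ : ∃ M, ∀ t ∈ Icc (0:ℝ) 1, ‖PP (ext x t)‖ ≤ M :=
    isCompact_Icc.exists_bound_of_continuousOn (PP_continuous.comp (ext_continuous x)).continuousOn
  have hδ : ∀ t ∈ Icc (0:ℝ) 1, ∀ ξ, 1 + ext D t 0 ξ = ext x t 4 ξ ∧ ext D t 3 ξ = ext x t 5 ξ := by
    intro t ht ξ
    have hg := gron' (K := |l| * (1 + M))
      (f := fun s => (1 + ext D s 0 ξ - ext x s 4 ξ)^2 + (ext D s 3 ξ - ext x s 5 ξ)^2)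
      (f' := fun s => 2 * l * (1 - PP (ext x s) ξ) * ((1 + ext D s 0 ξ - ext x s 4 ξ) * (ext D s 3 ξ - ext x s 5 ξ)))
      (fun s hs => by
        refine (((((hDt' 0 ξ s hs).const_add 1).fun_sub (hxt' 4 ξ s hs)).fun_pow 2).fun_add
          (((hDt' 3 ξ s hs).fun_sub (hxt' 5 ξ s hs)).fun_pow 2)).congr_deriv ?_
        rw [hΦ0 s hs, hΦ3 s hs, F4, F5, vff_pt]
        push_cast
        ring)
      (fun s hs => by
        set d1 := 1 + ext D s 0 ξ - ext x s 4 ξ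
        set d2 := ext D s 3 ξ - ext x s 5 ξ
        have hP : |1 - PP (ext x s) ξ| ≤ 1 + M := by
          refine (abs_sub _ _).trans ?_
          rw [abs_one]
          gcongr
          exact ((PP (ext x s)).norm_coe_le_norm ξ).trans (hM s hs)
        have h2 : 2 * |d1 * d2| ≤ d1^2 + d2^2 := by
          rw [abs_mul]; nlinarith [sq_nonneg (|d1| - |d2|), sq_abs d1, sq_abs d2]
        calc 2 * l * (1 - PP (ext x s) ξ) * (d1 * d2) ≤ |2 * l * (1 - PP (ext x s) ξ) * (d1 * d2)| := le_abs_self _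
          _ = (|l| * |1 - PP (ext x s) ξ|) * (2 * |d1 * d2|) := by
            rw [abs_mul, abs_mul, abs_mul, abs_two]; ring
          _ ≤ (|l| * (1 + M)) * (d1^2 + d2^2) := by
            have := (abs_nonneg _).trans hP
            gcongr) t ht
    have e0 : ext D 0 0 ξ = x0 4 ξ - 1 := (hDE 0 0 ξ).unique (by rw [ez]; exact h0.w' ξ)
    have e3 : ext D 0 3 ξ = x0 5 ξ := (hDE 0 3 ξ).unique (by rw [ez]; exact h0.U' ξ)
    simp only [ez, e0, e3] at hg
    have hz : (1 + (x0 4 ξ - 1) - x0 4 ξ) ^ 2 + (x0 5 ξ - x0 5 ξ) ^ 2 = 0 := by ring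
    rw [hz, zero_mul] at hg
    have q1 := sq_nonneg (1 + ext D t 0 ξ - ext x t 4 ξ)
    have q2 := sq_nonneg (ext D t 3 ξ - ext x t 5 ξ)
    have r1 : (1 + ext D t 0 ξ - ext x t 4 ξ)^2 = 0 := by linarith
    have r2 : (ext D t 3 ξ - ext x t 5 ξ)^2 = 0 := by linarith
    constructor
    · linarith [pow_eq_zero_iff (two_ne_zero) |>.1 r1]
    · linarith [pow_eq_zero_iff (two_ne_zero) |>.1 r2]
  have hinvE : ∀ t ∈ Icc (0:ℝ) 1, ∀ ξ, ext x t 4 ξ * ext x t 6 ξ - ext x t 4 ξ ^ 2 * ext x t 3 ξ ^ 2 - ext x t 5 ξ ^ 2 = r ξ := by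
    intro t ht ξ
    rw [← h0.inv ξ, ← ez]
    refine const_of (f := fun t => ext x t 4 ξ * ext x t 6 ξ - ext x t 4 ξ ^ 2 * ext x t 3 ξ ^ 2 - ext x t 5 ξ ^ 2) (fun s hs => ?_) t ht
    refine ((((hxt' 4 ξ s hs).fun_mul (hxt' 6 ξ s hs)).fun_sub
      (((hxt' 4 ξ s hs).fun_pow 2).fun_mul ((hxt' 3 ξ s hs).fun_pow 2))).fun_sub ((hxt' 5 ξ s hs).fun_pow 2)).congr_deriv ?_
    rw [F3, F4, F5, F6]
    push_cast
    ring
  have hpE : ∀ t ∈ Icc (0:ℝ) 1, ∀ ξ, 0 < ext x t 4 ξ := by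
    intro t ht ξ
    have hne : ∀ s ∈ Icc (0:ℝ) 1, ext x s 4 ξ ≠ 0 := by
      intro s hs h
      have := hinvE s hs ξ
      rw [h] at this
      nlinarith [hr ξ, sq_nonneg (ext x s 5 ξ)]
    by_contra hneg
    push Not at hneg
    have hcont : ContinuousOn (fun s => ext x s 4 ξ) (Icc 0 t) :=
      fun s hs => ((hxt' 4 ξ s ⟨hs.1, hs.2.trans ht.2⟩).continuousWithinAt).mono (Icc_subset_Icc_right ht.2)
    have := intermediate_value_Icc' ht.1 hcont (show (0:ℝ) ∈ _ from ⟨hneg, by rw [ez, h0p]; norm_num⟩)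
    obtain ⟨s, hs, hs'⟩ := this
    exact hne s ⟨hs.1, hs.2.trans ht.2⟩ hs'
  have hnuE : ∀ t ∈ Icc (0:ℝ) 1, intB (ext x t 6) = h := by
    intro t ht
    have e0 : intB (ext x 0 6) = h := by rw [ez]; exact h0.nu
    rw [← e0]
    refine const_of (f := fun t => intB (ext x t 6)) (fun s hs => ?_) t ht
    have h1 := ((intB.comp (ContinuousLinearMap.proj (R := ℝ) (φ := fun _ : Fin 7 => B) 6)).hasFDerivAt).comp_hasDerivWithinAt s (hxt s hs)
    refine (h1).congr_deriv ?_
    change intB (l • F (ext x s) 6) = 0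
    rw [map_smul, intB_apply]
    have hder : ∀ ξ ∈ uIcc (0:ℝ) 1, HasDerivAt (fun ξ => ext x s 3 ξ ^ 3 - 2 * (PP (ext x s) ξ * ext x s 3 ξ)) (F (ext x s) 6 ξ) ξ := by
      intro ξ _
      have d3 : HasDerivAt (ext x s 3) (ext x s 5 ξ) ξ := by rw [← (hδ s hs ξ).2]; exact hDE s 3 ξ
      have dP : HasDerivAt (PP (ext x s)) (QQ (ext x s) ξ * ext x s 4 ξ) ξ := by
        rw [← (hδ s hs ξ).1]; exact (hPQ s hs ξ).1
      refine ((d3.fun_pow 3).fun_sub ((dP.fun_mul d3).const_mul 2)).congr_deriv ?_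
      rw [F6]; push_cast; ring
    rw [intervalIntegral.integral_eq_sub_of_hasDerivAt hder ((F (ext x s) 6).continuous.intervalIntegrable _ _)]
    have p3 := hperE s 3 0
    have pP : PP (ext x s) (0 + 1) = PP (ext x s) 0 := by
      have : Tau 1 (ext x s) = ext x s := by ext i ξ; exact hperE s i ξ
      have h2 := vP_map (tau 1) (tau_Kop 1 1) (tau_Kop 1 (-1)) (ext x s)
      have h3 : (fun i => (tau 1) (ext x s i)) = ext x s := this
      rw [h3] at h2
      conv_rhs => rw [PP, h2]
      rfl
    rw [zero_add] at p3 pP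
    rw [p3, pP]; simp
  rw [← ext_coe]
  refine ⟨hperE t, haE t t.2, hbE t t.2, ?_, ?_, hinvE t t.2, hpE t t.2, hnuE t t.2⟩
  · intro ξ
    rw [← (hδ t t.2 ξ).1]
    simpa using hDE t 0 ξ
  · intro ξ
    rw [← (hδ t t.2 ξ).2]
    exact hDE t 3 ξ

end TCH

namespace TCH

section bounds
variable {h : ℝ} {r : ℝ → ℝ} {z : EE}

theorem Inv.dy (H : Inv h r z) (ξ : ℝ) : HasDerivAt (fun ξ => ξ + z 0 ξ) (z 4 ξ) ξ := by
  refine ((hasDerivAt_id ξ).fun_add (H.w' ξ)).congr_deriv ?_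
  ring

theorem Inv.mono (H : Inv h r z) : StrictMono (fun ξ => ξ + z 0 ξ) :=
  strictMono_of_hasDerivAt_pos (H.dy) (H.p)

theorem Inv.perm (H : Inv h r z) (i : Fin 7) (ξ : ℝ) : z i (ξ - 1) = z i ξ := by
  rw [← H.per i (ξ - 1)]; simp

theorem Inv.up (H : Inv h r z) (hr : ∀ ξ, 0 < r ξ) (ξ : ℝ) :
    z 3 ξ ^ 2 * z 4 ξ ≤ z 6 ξ ∧ 2 * |z 3 ξ * z 5 ξ| ≤ z 6 ξ ∧ 0 < z 6 ξ := by
  have hp := H.p ξ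
  have hi := H.inv ξ
  have hrr := hr ξ
  refine ⟨?_, ?_, ?_⟩
  · refine le_of_mul_le_mul_left ?_ hp
    nlinarith [sq_nonneg (z 5 ξ)]
  · refine le_of_mul_le_mul_left ?_ hp
    rw [abs_mul]
    nlinarith [sq_nonneg (z 4 ξ * |z 3 ξ| - |z 5 ξ|), sq_abs (z 3 ξ), sq_abs (z 5 ξ)]
  · refine pos_of_mul_pos_right (a := z 4 ξ) ?_ hp.le
    nlinarith [sq_nonneg (z 5 ξ), sq_nonneg (z 4 ξ * z 3 ξ)]

theorem Inv.int (H : Inv h r z) (ξ : ℝ) : ∫ η in (ξ - 1)..ξ, z 6 η = h := by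
  have h1 : Function.Periodic (z 6) 1 := fun x => H.per 6 x
  have := h1.intervalIntegral_add_eq (ξ - 1) 0
  simp only [sub_add_cancel, zero_add] at this
  rw [this, H.nu]

theorem Inv.Ubound (H : Inv h r z) (hr : ∀ ξ, 0 < r ξ) (ξ : ℝ) : z 3 ξ ^ 2 ≤ 2 * h := by
  have cii (i : Fin 7) (a b : ℝ) : IntervalIntegrable (z i) volume a b := (z i).continuous.intervalIntegrable _ _
  have h1 : ∀ η ∈ Icc (ξ - 1) ξ, z 3 ξ ^ 2 - z 3 η ^ 2 ≤ h := by
    intro η hη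
    have hd : ∀ x ∈ uIcc η ξ, HasDerivAt (fun x => z 3 x ^ 2) (2 * (z 3 x * z 5 x)) x := by
      intro x _
      refine ((H.U' x).fun_pow 2).congr_deriv ?_
      push_cast; ring
    rw [← intervalIntegral.integral_eq_sub_of_hasDerivAt hd
      (Continuous.intervalIntegrable (by fun_prop) _ _)]
    have e1 : ∫ x in η..ξ, 2 * (z 3 x * z 5 x) ≤ ∫ x in η..ξ, z 6 x := by
      apply intervalIntegral.integral_mono_on hη.2 (Continuous.intervalIntegrable (by fun_prop) _ _) (cii _ _ _)
      intro x _
      have := (H.up hr x).2.1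
      linarith [le_abs_self (z 3 x * z 5 x)]
    have e2 : 0 ≤ ∫ x in (ξ - 1)..η, z 6 x :=
      intervalIntegral.integral_nonneg hη.1 fun x _ => (H.up hr x).2.2.le
    have e3 := intervalIntegral.integral_add_adjacent_intervals (cii 6 (ξ - 1) η) (cii 6 η ξ)
    rw [H.int] at e3
    linarith
  have h2 : ∫ η in (ξ - 1)..ξ, z 4 η = 1 := by
    rw [intervalIntegral.integral_eq_sub_of_hasDerivAt (fun x _ => H.dy x) (cii _ _ _)]
    rw [H.perm]; ring
  have h3 : ∫ η in (ξ - 1)..ξ, (z 3 ξ ^ 2 - h) * z 4 η ≤ ∫ η in (ξ - 1)..ξ, z 6 η := by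
    apply intervalIntegral.integral_mono_on (by linarith) (Continuous.intervalIntegrable (by fun_prop) _ _) (cii _ _ _)
    intro η hη
    refine le_trans ?_ (H.up hr η).1
    have := H.p η
    gcongr
    linarith [h1 η hη]
  rw [intervalIntegral.integral_const_mul, h2, H.int] at h3
  linarith

theorem Inv.Kbound (H : Inv h r z) (hr : ∀ ξ, 0 < r ξ) (ξ : ℝ) {σ : ℝ} (g g' : B)
    (hg : ∀ θ ∈ Icc (0:ℝ) 1, g ξ * (Real.exp (σ * (θ - 1/2)) * g' (ξ - θ)) ≤ Real.exp (1/2))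
    (hg0 : ∀ ξ, 0 ≤ g ξ) (hg0' : ∀ ξ, 0 ≤ g' ξ) :
    0 ≤ g ξ * Kop σ (g' * vff z) ξ ∧ g ξ * Kop σ (g' * vff z) ξ ≤ Real.exp (1/2) * h := by
  have hf (x : ℝ) : 0 ≤ vff z x ∧ vff z x ≤ z 6 x := by
    rw [vff_pt]
    obtain ⟨h1, h2, h3⟩ := H.up hr x
    have := H.p x
    constructor
    · have := mul_nonneg (mul_self_nonneg (z 3 x)) this.le
      linarith
    · nlinarith
  rw [Kop_apply, ← intervalIntegral.integral_const_mul]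
  constructor
  · apply intervalIntegral.integral_nonneg zero_le_one
    intro θ _
    have := (hf (ξ - θ)).1
    have := hg0 ξ
    have := hg0' (ξ - θ)
    simp only [BoundedContinuousFunction.coe_mul, Pi.mul_apply]
    positivity
  · have e : ∫ θ in (0:ℝ)..1, Real.exp (1/2) * z 6 (ξ - θ) = Real.exp (1/2) * h := by
      rw [intervalIntegral.integral_const_mul, intervalIntegral.integral_comp_sub_left (z 6), sub_zero, H.int]
    rw [← e]
    apply intervalIntegral.integral_mono_on zero_le_one (Continuous.intervalIntegrable (by fun_prop) _ _)
      (Continuous.intervalIntegrable (by fun_prop) _ _)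
    intro θ hθ
    simp only [BoundedContinuousFunction.coe_mul, Pi.mul_apply]
    calc g ξ * (Real.exp (σ * (θ - 1/2)) * (g' (ξ - θ) * vff z (ξ - θ)))
        = (g ξ * (Real.exp (σ * (θ - 1/2)) * g' (ξ - θ))) * vff z (ξ - θ) := by ring
      _ ≤ Real.exp (1/2) * z 6 (ξ - θ) :=
        mul_le_mul (hg θ hθ) (hf _).2 (hf _).1 (Real.exp_pos _).le

theorem Inv.PQbound (H : Inv h r z) (hr : ∀ ξ, 0 < r ξ) (ξ : ℝ) :
    |PP z ξ| ≤ cK * (2 * (Real.exp (1/2) * h)) ∧ |QQ z ξ| ≤ cK * (2 * (Real.exp (1/2) * h)) := by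
  have hy : ∀ θ ∈ Icc (0:ℝ) 1, 0 ≤ θ + z 0 ξ - z 0 (ξ - θ) ∧ θ + z 0 ξ - z 0 (ξ - θ) ≤ 1 := by
    intro θ hθ
    have h1 := H.mono.monotone (show ξ - θ ≤ ξ by linarith [hθ.1])
    have h2 := H.mono.monotone (show ξ - 1 ≤ ξ - θ by linarith [hθ.2])
    simp only [H.perm] at h1 h2
    constructor <;> linarith
  have k1 := H.Kbound hr ξ (σ := 1) (z 1) (z 2) (fun θ hθ => by
      rw [H.a, H.b, ← Real.exp_add, ← Real.exp_add]
      apply Real.exp_le_exp.2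
      linarith [(hy θ hθ).2]) (fun ξ => by rw [H.a]; positivity) (fun ξ => by rw [H.b]; positivity)
  have k2 := H.Kbound hr ξ (σ := -1) (z 2) (z 1) (fun θ hθ => by
      rw [H.a, H.b, ← Real.exp_add, ← Real.exp_add]
      apply Real.exp_le_exp.2
      linarith [(hy θ hθ).1]) (fun ξ => by rw [H.b]; positivity) (fun ξ => by rw [H.a]; positivity)
  rw [PP_pt, QQ_pt, abs_mul, abs_mul, abs_of_pos cK_pos]
  constructor
  · refine mul_le_mul_of_nonneg_left ?_ cK_pos.le
    rw [abs_le]; constructor <;> linarith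
  · refine mul_le_mul_of_nonneg_left ?_ cK_pos.le
    rw [abs_le]; constructor <;> linarith

end bounds

theorem scalar_ineq (l u c P Q U p q n : ℝ) (a1 : |U| ≤ u) (a2 : |P| ≤ c) (a3 : |Q| ≤ c) :
    l * (2 * (p * q) + 1/2 * (2 * (q * n)) + (1/2 * (U * U) - P) * (2 * (p * q)) - (2 * (Q * U)) * (2 * (p * n))
          + (3 * (U * U) - 2 * P) * (2 * (q * n))) ≤
      |l| * (2 + (u^2 + c) + 2 * (c * u) + (3 * u^2 + 2 * c)) * (p^2 + q^2 + n^2) := by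
  have hu0 : 0 ≤ u := (abs_nonneg _).trans a1
  have hc0 : 0 ≤ c := (abs_nonneg _).trans a2
  have a4 : |U * U| ≤ u^2 := by rw [abs_mul, sq]; gcongr
  have b1 : |1/2 * (U * U) - P| ≤ u^2 + c := by
    refine (abs_sub _ _).trans (add_le_add ?_ a2)
    rw [abs_mul, abs_of_pos (by norm_num : (0:ℝ) < 1/2)]
    linarith [abs_nonneg (U * U)]
  have b2 : |2 * (Q * U)| ≤ 2 * (c * u) := by
    rw [abs_mul, abs_mul, abs_two]; gcongr
  have b3 : |3 * (U * U) - 2 * P| ≤ 3 * u^2 + 2 * c := by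
    refine (abs_sub _ _).trans (add_le_add ?_ ?_)
    · rw [abs_mul, abs_of_pos (by norm_num : (0:ℝ) < 3)]; linarith
    · rw [abs_mul, abs_two]; linarith
  set e := p^2 + q^2 + n^2 with he
  have he0 : 0 ≤ e := by positivity
  have m1 : |2 * (p * q)| ≤ e := by
    rw [abs_le]; constructor <;> nlinarith only [sq_nonneg (p + q), sq_nonneg (p - q), sq_nonneg n, he]
  have m2 : |2 * (p * n)| ≤ e := by
    rw [abs_le]; constructor <;> nlinarith only [sq_nonneg (p + n), sq_nonneg (p - n), sq_nonneg q, he]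
  have m3 : |2 * (q * n)| ≤ e := by
    rw [abs_le]; constructor <;> nlinarith only [sq_nonneg (q + n), sq_nonneg (q - n), sq_nonneg p, he]
  have c1 : |(1/2 * (U * U) - P) * (2 * (p * q))| ≤ (u^2 + c) * e := by rw [abs_mul]; gcongr
  have c2 : |(2 * (Q * U)) * (2 * (p * n))| ≤ (2 * (c * u)) * e := by rw [abs_mul]; gcongr
  have c3 : |(3 * (U * U) - 2 * P) * (2 * (q * n))| ≤ (3 * u^2 + 2 * c) * e := by rw [abs_mul]; gcongr
  refine (le_abs_self _).trans ?_
  rw [abs_mul, mul_assoc |l|]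
  refine mul_le_mul_of_nonneg_left ?_ (abs_nonneg l)
  generalize (1/2 * (U * U) - P) * (2 * (p * q)) = A1 at *
  generalize (2 * (Q * U)) * (2 * (p * n)) = A2 at *
  generalize (3 * (U * U) - 2 * P) * (2 * (q * n)) = A3 at *
  generalize 2 * (p * q) = A4 at *
  generalize 2 * (q * n) = A5 at *
  rw [abs_le] at c1 c2 c3 m1 m3
  rw [abs_le]
  constructor <;> linarith only [c1.1, c1.2, c2.1, c2.2, c3.1, c3.2, m1.1, m1.2, m3.1, m3.2, he0]

theorem apriori {x0 : EE} {r : ℝ → ℝ} {h : ℝ} (h0 : Inv h r x0) (hr : ∀ ξ, 0 < r ξ)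
    (h0p : ∀ ξ, x0 4 ξ = 1)
    (h0s : ContDiff ℝ (⊤ : ℕ∞) (fun s => Tau s x0)) (T : ℝ) :
    ∃ M : ℝ, ∀ l : ℝ, |l| ≤ T → ∀ x, IsSol F l x0 x → ∀ t, ‖x t‖ ≤ M := by
  set u := Real.sqrt (2 * h) with hu
  set c := cK * (2 * (Real.exp (1/2) * h)) with hc
  set K := 2 + (u^2 + c) + 2 * (c * u) + (3 * u^2 + 2 * c) with hK
  set N := (3 * ‖x0‖^2) * Real.exp (T * K) with hN
  set W := ‖x0‖ + T * u with hW
  refine ⟨W + Real.exp W + u + Real.sqrt N, ?_⟩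
  intro l hl x hx
  have HI (t : ℝ) : Inv h r (ext x t) := invariants h0 hr h0p h0s hx _
  have hT : 0 ≤ T := (abs_nonneg l).trans hl
  have hU (t ξ : ℝ) : |ext x t 3 ξ| ≤ u := by
    rw [hu]; exact Real.abs_le_sqrt ((HI t).Ubound hr ξ)
  have hP (t ξ : ℝ) : |PP (ext x t) ξ| ≤ c := ((HI t).PQbound hr ξ).1
  have hQ (t ξ : ℝ) : |QQ (ext x t) ξ| ≤ c := ((HI t).PQbound hr ξ).2
  have hc0 : 0 ≤ c := (abs_nonneg _).trans (hP 0 0)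
  have hu0 : 0 ≤ u := Real.sqrt_nonneg _
  have hK0 : 0 ≤ K := by positivity
  have hN0 : 0 ≤ N := by positivity
  have hW0 : 0 ≤ W := by positivity
  have hxt := hx.hasDerivAt_aux good.cF.continuous
  have ez : ext x 0 = x0 := hx.zero
  have hxt' (i : Fin 7) (ξ : ℝ) (t : ℝ) (ht : t ∈ Icc (0:ℝ) 1) :
      HasDerivWithinAt (fun r => ext x r i ξ) (l * F (ext x t) i ξ) (Icc 0 1) t :=
    ev_hasDeriv (hxt t ht) i ξ
  have hx0 (i : Fin 7) (ξ : ℝ) : |x0 i ξ| ≤ ‖x0‖ :=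
    ((x0 i).norm_coe_le_norm ξ).trans (norm_le_pi_norm x0 i)
  have hw (t : ℝ) (ht : t ∈ Icc (0:ℝ) 1) (ξ : ℝ) : |ext x t 0 ξ| ≤ W := by
    have := (convex_Icc (0:ℝ) 1).norm_image_sub_le_of_norm_hasDerivWithin_le (C := T * u)
      (hxt' 0 ξ) (fun s hs => by
        rw [norm_mul, F0]
        exact mul_le_mul hl (hU s ξ) (norm_nonneg _) hT) (show (0:ℝ) ∈ Icc (0:ℝ) 1 by simp) ht
    rw [ez] at this
    have e1 := hx0 0 ξ
    have e2 : T * u * ‖t - 0‖ ≤ T * u := by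
      refine mul_le_of_le_one_right (by positivity) ?_
      rw [sub_zero, Real.norm_of_nonneg ht.1]; exact ht.2
    have e3 := abs_sub_abs_le_abs_sub (ext x t 0 ξ) (x0 0 ξ)
    rw [Real.norm_eq_abs] at this
    linarith
  have hpq (t : ℝ) (ht : t ∈ Icc (0:ℝ) 1) (ξ : ℝ) : ext x t 4 ξ ^ 2 + ext x t 5 ξ ^ 2 + ext x t 6 ξ ^ 2 ≤ N := by
    have hg := gron' (K := |l| * K) (f := fun t => ext x t 4 ξ ^ 2 + ext x t 5 ξ ^ 2 + ext x t 6 ξ ^ 2)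
      (fun s hs => (((hxt' 4 ξ s hs).fun_pow 2).fun_add ((hxt' 5 ξ s hs).fun_pow 2)).fun_add ((hxt' 6 ξ s hs).fun_pow 2))
      (fun s hs => by
        rw [F4, F5, F6]
        refine le_trans (le_of_eq ?_) (scalar_ineq l u c _ _ _ (ext x s 4 ξ) (ext x s 5 ξ) (ext x s 6 ξ) (hU s ξ) (hP s ξ) (hQ s ξ))
        push_cast; ring) t ht
    simp only [ez] at hg
    refine hg.trans ?_
    rw [hN]
    refine mul_le_mul ?_ (Real.exp_le_exp.2 ?_) (Real.exp_pos _).le (by positivity)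
    · have := hx0 4 ξ
      have := hx0 5 ξ
      have := hx0 6 ξ
      have k (a : ℝ) (ha : |a| ≤ ‖x0‖) : a^2 ≤ ‖x0‖^2 := sq_le_sq' (abs_le.1 ha).1 (abs_le.1 ha).2
      linarith [k _ (hx0 4 ξ), k _ (hx0 5 ξ), k _ (hx0 6 ξ)]
    · calc |l| * K * t ≤ |l| * K * 1 := by gcongr; exact ht.2
        _ ≤ T * K := by rw [mul_one]; gcongr
  intro t
  have hs0 := Real.sqrt_nonneg N
  have he0 := (Real.exp_pos W).le
  rw [← ext_coe, pi_norm_le_iff_of_nonneg (by positivity)]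
  intro i
  rw [BoundedContinuousFunction.norm_le (by positivity)]
  intro ξ
  rw [Real.norm_eq_abs]
  have hwt := hw t t.2 ξ
  have hn := hpq t t.2 ξ
  have hUt := hU t ξ
  have s4 : |ext x t 4 ξ| ≤ Real.sqrt N := Real.abs_le_sqrt (by nlinarith [sq_nonneg (ext x t 5 ξ), sq_nonneg (ext x t 6 ξ)])
  have s5 : |ext x t 5 ξ| ≤ Real.sqrt N := Real.abs_le_sqrt (by nlinarith [sq_nonneg (ext x t 4 ξ), sq_nonneg (ext x t 6 ξ)])
  have s6 : |ext x t 6 ξ| ≤ Real.sqrt N := Real.abs_le_sqrt (by nlinarith [sq_nonneg (ext x t 5 ξ), sq_nonneg (ext x t 4 ξ)])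
  have s1 : |ext x t 1 ξ| ≤ Real.exp W := by
    rw [(HI t).a, abs_of_pos (Real.exp_pos _)]; exact Real.exp_le_exp.2 (abs_le.1 hwt).2
  have s2 : |ext x t 2 ξ| ≤ Real.exp W := by
    rw [(HI t).b, abs_of_pos (Real.exp_pos _)]; exact Real.exp_le_exp.2 (by linarith [(abs_le.1 hwt).1])
  fin_cases i <;> simp only [Fin.zero_eta, Fin.mk_one, Fin.reduceFinMk] <;> linarith

theorem lagrangian {x0 : EE} {r : ℝ → ℝ} {h : ℝ} (h0 : Inv h r x0) (hr : ∀ ξ, 0 < r ξ)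
    (h0p : ∀ ξ, x0 4 ξ = 1) (h0s : ContDiff ℝ (⊤ : ℕ∞) (fun s => Tau s x0)) :
    ∃ z : ℝ → EE, z 0 = x0 ∧ (∀ t, HasDerivAt z (F (z t)) t) ∧
      (∀ i, ContDiff ℝ (⊤ : ℕ∞) (fun v : ℝ × ℝ => z v.1 i v.2)) ∧ ∀ t, Inv h r (z t) := by
  choose X hX using good.global x0 (apriori h0 hr h0p h0s)
  refine ⟨fun l => X l ⟨1, by simp⟩, ?_, fun t => good.flow_deriv hX t, fun i => joint_smooth hX h0s i _,
    fun t => invariants h0 hr h0p h0s (hX t) _⟩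
  have := hX 0 ⟨1, by simp⟩
  simpa using this

end TCH

namespace TCH

/-- Smoothness of a curried function on the strip `A × ℝ`. -/
def Sm (A : Set ℝ) (u : ℝ → ℝ → ℝ) : Prop :=
  ContDiffOn ℝ (⊤ : ℕ∞) (Function.uncurry u) (A ×ˢ (Set.univ : Set ℝ))

section calculus
variable {A : Set ℝ} {u v : ℝ → ℝ → ℝ}

theorem Sm.add (hu : Sm A u) (hv : Sm A v) : Sm A (fun t x => u t x + v t x) :=
  ContDiffOn.add hu hv
theorem Sm.sub (hu : Sm A u) (hv : Sm A v) : Sm A (fun t x => u t x - v t x) :=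
  ContDiffOn.sub hu hv
theorem Sm.mul (hu : Sm A u) (hv : Sm A v) : Sm A (fun t x => u t x * v t x) :=
  ContDiffOn.mul hu hv
theorem Sm.neg (hu : Sm A u) : Sm A (fun t x => - u t x) :=
  ContDiffOn.neg hu
theorem Sm.cst (c : ℝ) : Sm A (fun _ _ => c) := contDiffOn_const
theorem Sm.mono {A' : Set ℝ} (hu : Sm A u) (h : A' ⊆ A) : Sm A' u :=
  ContDiffOn.mono hu (prod_mono h subset_rfl)

theorem Sm.fd (hu : Sm A u) {t : ℝ} (ht : t ∈ A) (x : ℝ) :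
    HasFDerivWithinAt (uncurry u) (fderivWithin ℝ (uncurry u) (A ×ˢ univ) (t, x)) (A ×ˢ univ) (t, x) :=
  (hu.differentiableOn (by simp) (t, x) ⟨ht, mem_univ _⟩).hasFDerivWithinAt

theorem Sm.hasX0 (hu : Sm A u) {t : ℝ} (ht : t ∈ A) (x : ℝ) :
    HasDerivAt (fun z => u t z) (fderivWithin ℝ (uncurry u) (A ×ˢ univ) (t, x) (0, 1)) x := by
  have h2 : HasDerivWithinAt (fun z : ℝ => (t, z)) ((0:ℝ), (1:ℝ)) univ x :=
    ((hasDerivAt_const x t).prodMk (hasDerivAt_id x)).hasDerivWithinAt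
  have := (hu.fd ht x).comp_hasDerivWithinAt x h2 (fun z _ => ⟨ht, mem_univ _⟩)
  exact hasDerivWithinAt_univ.1 this

theorem Sm.eqX (hu : Sm A u) {t : ℝ} (ht : t ∈ A) (x : ℝ) :
    partialX u t x = fderivWithin ℝ (uncurry u) (A ×ˢ univ) (t, x) (0, 1) := (hu.hasX0 ht x).deriv

theorem Sm.hasX (hu : Sm A u) {t : ℝ} (ht : t ∈ A) (x : ℝ) :
    HasDerivAt (fun z => u t z) (partialX u t x) x := by
  rw [hu.eqX ht]; exact hu.hasX0 ht x

theorem Sm.chain0 (hA : IsOpen A) (hu : Sm A u) {t : ℝ} (ht : t ∈ A) {y : ℝ → ℝ} {y' : ℝ}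
    (hy : HasDerivAt y y' t) :
    HasDerivAt (fun s => u s (y s)) (fderivWithin ℝ (uncurry u) (A ×ˢ univ) (t, y t) (1, y')) t := by
  have h2 : HasDerivAt (fun s : ℝ => (s, y s)) ((1:ℝ), y') t := (hasDerivAt_id t).prodMk hy
  have h3 : HasFDerivAt (uncurry u) (fderivWithin ℝ (uncurry u) (A ×ˢ univ) (t, y t)) (t, y t) :=
    (hu.fd ht (y t)).hasFDerivAt ((hA.prod isOpen_univ).mem_nhds ⟨ht, mem_univ _⟩)
  exact h3.comp_hasDerivAt t h2

theorem Sm.eqT (hA : IsOpen A) (hu : Sm A u) {t : ℝ} (ht : t ∈ A) (x : ℝ) :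
    partialT u t x = fderivWithin ℝ (uncurry u) (A ×ˢ univ) (t, x) (1, 0) :=
  (hu.chain0 hA ht (hasDerivAt_const t x)).deriv

theorem Sm.hasT (hA : IsOpen A) (hu : Sm A u) {t : ℝ} (ht : t ∈ A) (x : ℝ) :
    HasDerivAt (fun s => u s x) (partialT u t x) t := by
  rw [hu.eqT hA ht]; exact hu.chain0 hA ht (hasDerivAt_const t x)

theorem Sm.chain (hA : IsOpen A) (hu : Sm A u) {t : ℝ} (ht : t ∈ A) {y : ℝ → ℝ} {y' : ℝ}
    (hy : HasDerivAt y y' t) :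
    HasDerivAt (fun s => u s (y s)) (partialT u t (y t) + partialX u t (y t) * y') t := by
  refine (hu.chain0 hA ht hy).congr_deriv ?_
  rw [hu.eqT hA ht, hu.eqX ht]
  have : ((1:ℝ), y') = (1, 0) + y' • ((0:ℝ), (1:ℝ)) := by simp
  rw [this, map_add, map_smul, smul_eq_mul, mul_comm]

theorem Sm.dv (hA : UniqueDiffOn ℝ A) (hu : Sm A u) (e : ℝ × ℝ) :
    ContDiffOn ℝ (⊤ : ℕ∞) (fun v => fderivWithin ℝ (uncurry u) (A ×ˢ univ) v e) (A ×ˢ univ) := by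
  have h := hu.fderivWithin (m := ((⊤ : ℕ∞) : WithTop ℕ∞)) (hA.prod uniqueDiffOn_univ) (by simp)
  exact h.clm_apply contDiffOn_const

theorem Sm.dX (hA : UniqueDiffOn ℝ A) (hu : Sm A u) : Sm A (partialX u) :=
  (hu.dv hA (0, 1)).congr (fun v hv => hu.eqX hv.1 v.2)

theorem Sm.dT (hA : IsOpen A) (hu : Sm A u) : Sm A (partialT u) :=
  (hu.dv hA.uniqueDiffOn (1, 0)).congr (fun v hv => hu.eqT hA hv.1 v.2)

theorem Sm.comm (hA : IsOpen A) (hu : Sm A u) {t : ℝ} (ht : t ∈ A) (x : ℝ) :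
    partialT (partialX u) t x = partialX (partialT u) t x := by
  have hS : IsOpen (A ×ˢ (univ : Set ℝ)) := hA.prod isOpen_univ
  have hm : (t, x) ∈ A ×ˢ (univ : Set ℝ) := ⟨ht, mem_univ _⟩
  have hn := hS.mem_nhds hm
  have hc : ContDiffAt ℝ (⊤ : ℕ∞) (uncurry u) (t, x) := ContDiffOn.contDiffAt hu hn
  have hsym : IsSymmSndFDerivAt ℝ (uncurry u) (t, x) := hc.isSymmSndFDerivAt (by simpa using WithTop.coe_le_coe.2 (le_top (a := (2:ℕ∞))))
  have hd : DifferentiableAt ℝ (fderiv ℝ (uncurry u)) (t, x) :=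
    (hc.fderiv_right (m := ((⊤ : ℕ∞) : WithTop ℕ∞)) (by simp)).differentiableAt (by simp)
  have key (e : ℝ × ℝ) : HasFDerivAt (fun v => fderivWithin ℝ (uncurry u) (A ×ˢ univ) v e)
      ((fderiv ℝ (fderiv ℝ (uncurry u)) (t, x)).flip e) (t, x) := by
    have h1 : HasFDerivAt (fun v => fderiv ℝ (uncurry u) v e)
      ((fderiv ℝ (fderiv ℝ (uncurry u)) (t, x)).flip e) (t, x) := by
      simpa using hd.hasFDerivAt.clm_apply (hasFDerivAt_const e (t, x))
    refine h1.congr_of_eventuallyEq ?_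
    filter_upwards [hn] with v hv
    rw [fderivWithin_of_isOpen hS hv]
  have e1 : HasDerivAt (fun s => partialX u s x)
      (fderiv ℝ (fderiv ℝ (uncurry u)) (t, x) (1, 0) (0, 1)) t := by
    have h2 : HasDerivAt (fun s : ℝ => (s, x)) ((1:ℝ), (0:ℝ)) t :=
      (hasDerivAt_id t).prodMk (hasDerivAt_const t x)
    have := (key (0, 1)).comp_hasDerivAt t h2
    refine HasDerivAt.congr_of_eventuallyEq (f := _) this ?_
    filter_upwards [hA.mem_nhds ht] with s hs
    exact hu.eqX hs x
  have e2 : HasDerivAt (fun z => partialT u t z)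
      (fderiv ℝ (fderiv ℝ (uncurry u)) (t, x) (0, 1) (1, 0)) x := by
    have h2 : HasDerivAt (fun z : ℝ => (t, z)) ((0:ℝ), (1:ℝ)) x :=
      (hasDerivAt_const x t).prodMk (hasDerivAt_id x)
    have := (key (1, 0)).comp_hasDerivAt x h2
    refine HasDerivAt.congr_of_eventuallyEq (f := _) this ?_
    filter_upwards with z
    exact hu.eqT hA ht z
  rw [partialT, partialX, e1.deriv, e2.deriv]
  exact hsym _ _

end calculus

theorem euler_eqs {y U p q ν P Q u ρ : ℝ → ℝ → ℝ} {R : ℝ → ℝ}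
    (hu : Sm univ u) (hρ : Sm univ ρ)
    (hsurj : ∀ t x, ∃ ξ, y t ξ = x)
    (hp : ∀ t ξ, 0 < p t ξ)
    (yx : ∀ t ξ, HasDerivAt (y t) (p t ξ) ξ)
    (yt : ∀ t ξ, HasDerivAt (fun s => y s ξ) (U t ξ) t)
    (Ux : ∀ t ξ, HasDerivAt (U t) (q t ξ) ξ)
    (Ut : ∀ t ξ, HasDerivAt (fun s => U s ξ) (- Q t ξ) t)
    (pt : ∀ t ξ, HasDerivAt (fun s => p s ξ) (q t ξ) t)
    (Px : ∀ t ξ, HasDerivAt (P t) (Q t ξ * p t ξ) ξ)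
    (Qx : ∀ t ξ, HasDerivAt (Q t) (P t ξ * p t ξ - 1/2 * (U t ξ ^ 2 * p t ξ + ν t ξ)) ξ)
    (inv : ∀ t ξ, p t ξ * ν t ξ = p t ξ ^ 2 * U t ξ ^ 2 + q t ξ ^ 2 + R ξ ^ 2)
    (hU : ∀ t ξ, u t (y t ξ) = U t ξ) (hR : ∀ t ξ, ρ t (y t ξ) * p t ξ = R ξ) :
    Is2CH 0 1 u ρ := by
  have ou : IsOpen (univ : Set ℝ) := isOpen_univ
  have uu : UniqueDiffOn ℝ (univ : Set ℝ) := uniqueDiffOn_univ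
  have m (t : ℝ) : t ∈ (univ : Set ℝ) := mem_univ t
  have hux := hu.dX uu
  have huxx := hux.dX uu
  have hut := hu.dT ou
  have hutx := hut.dX uu
  have hQe : Sm univ (fun t x => -(partialT u t x + u t x * partialX u t x)) :=
    (hut.add (hu.mul hux)).neg
  have cx {G : ℝ → ℝ → ℝ} (hG : Sm univ G) (t ξ : ℝ) :
      HasDerivAt (fun ξ => G t (y t ξ)) (partialX G t (y t ξ) * p t ξ) ξ :=
    HasDerivAt.comp ξ (hG.hasX (m t) (y t ξ)) (yx t ξ)
  have ct {G : ℝ → ℝ → ℝ} (hG : Sm univ G) (t ξ : ℝ) :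
      HasDerivAt (fun s => G s (y s ξ)) (partialT G t (y t ξ) + partialX G t (y t ξ) * U t ξ) t :=
    hG.chain ou (m t) (yt t ξ)
  have e1 (t ξ : ℝ) : partialX u t (y t ξ) * p t ξ = q t ξ := by
    refine (cx hu t ξ).unique ?_
    simpa only [hU] using Ux t ξ
  have e2 (t ξ : ℝ) : partialT u t (y t ξ) + partialX u t (y t ξ) * U t ξ = - Q t ξ := by
    refine (ct hu t ξ).unique ?_
    simpa only [hU] using Ut t ξ
  set Qe : ℝ → ℝ → ℝ := fun t x => -(partialT u t x + u t x * partialX u t x) with Qe_def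
  have e3 (t ξ : ℝ) : Qe t (y t ξ) = Q t ξ := by
    simp only [Qe_def, hU]; linarith [e2 t ξ]
  have e4 (t ξ : ℝ) : partialX Qe t (y t ξ) * p t ξ
      = P t ξ * p t ξ - 1/2 * (U t ξ ^ 2 * p t ξ + ν t ξ) := by
    refine (cx hQe t ξ).unique ?_
    simp only [e3]; exact Qx t ξ
  set fe : ℝ → ℝ → ℝ := fun t x => u t x * u t x + 1/2 * (partialX u t x * partialX u t x)
    + 1/2 * (ρ t x * ρ t x) with fe_def
  have hfe : Sm univ fe :=
    ((hu.mul hu).add ((Sm.cst (1/2)).mul (hux.mul hux))).add ((Sm.cst (1/2)).mul (hρ.mul hρ))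
  have hPe : Sm univ (fun t x => partialX Qe t x + fe t x) := (hQe.dX uu).add hfe
  have e5 (t ξ : ℝ) : partialX Qe t (y t ξ) + fe t (y t ξ) = P t ξ := by
    have h0 := hp t ξ
    have h1 := e4 t ξ
    have h2 := e1 t ξ
    have h3 := hR t ξ
    have h4 := inv t ξ
    have : (p t ξ)^2 * (partialX Qe t (y t ξ) + fe t (y t ξ)) = (p t ξ)^2 * P t ξ := by
      simp only [fe_def, hU]
      rw [← h2, ← h3] at h4
      linear_combination (p t ξ) * h1 + (-1/2) * h4
    exact mul_left_cancel₀ (pow_ne_zero 2 h0.ne') this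
  set Pe : ℝ → ℝ → ℝ := fun t x => partialX Qe t x + fe t x with Pe_def
  have e6 (t ξ : ℝ) : partialX Pe t (y t ξ) = Qe t (y t ξ) := by
    have : partialX Pe t (y t ξ) * p t ξ = Q t ξ * p t ξ := by
      refine (cx hPe t ξ).unique ?_
      simp only [Pe_def, e5]; exact Px t ξ
    rw [e3]
    exact mul_right_cancel₀ (hp t ξ).ne' this
  intro t _ x
  have a1 : partialX Pe t x = Qe t x := by
    obtain ⟨ξ, rfl⟩ := hsurj t x; exact e6 t ξ
  have b1 (x : ℝ) : partialX Qe t x = -(partialX (partialT u) t x +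
      (partialX u t x * partialX u t x + u t x * partialX (partialX u) t x)) :=
    ((hut.hasX (m t) x).fun_add ((hu.hasX (m t) x).fun_mul (hux.hasX (m t) x))).fun_neg.deriv
  have hQx : (fun z => partialX Qe t z) = fun x => -(partialX (partialT u) t x +
      (partialX u t x * partialX u t x + u t x * partialX (partialX u) t x)) := funext b1
  have b2 : HasDerivAt (fun z => partialX Qe t z) (-(partialX (partialX (partialT u)) t x +
      ((partialX (partialX u) t x * partialX u t x + partialX u t x * partialX (partialX u) t x) +
       (partialX u t x * partialX (partialX u) t x + u t x * partialX (partialX (partialX u)) t x)))) x := by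
    rw [hQx]
    exact ((hutx.hasX (m t) x).fun_add (((hux.hasX (m t) x).fun_mul (hux.hasX (m t) x)).fun_add
      ((hu.hasX (m t) x).fun_mul (huxx.hasX (m t) x)))).fun_neg
  have b3 : HasDerivAt (fun z => fe t z) (partialX u t x * u t x + u t x * partialX u t x
      + 1/2 * (partialX (partialX u) t x * partialX u t x + partialX u t x * partialX (partialX u) t x)
      + 1/2 * (partialX ρ t x * ρ t x + ρ t x * partialX ρ t x)) x :=
    (((hu.hasX (m t) x).fun_mul (hu.hasX (m t) x)).fun_add
      (((hux.hasX (m t) x).fun_mul (hux.hasX (m t) x)).const_mul (1/2))).fun_add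
      (((hρ.hasX (m t) x).fun_mul (hρ.hasX (m t) x)).const_mul (1/2))
  have b4 : partialX Pe t x = _ := (b2.fun_add b3).deriv
  have c1 : partialT (partialX (partialX u)) t x = partialX (partialX (partialT u)) t x := by
    rw [hux.comm ou (m t)]
    have : (fun z => partialT (partialX u) t z) = fun z => partialX (partialT u) t z := by
      ext z; exact hu.comm ou (m t) z
    simp only [partialX] at this ⊢
    rw [this]
  constructor
  · rw [c1]
    rw [b4] at a1
    simp only [Qe_def] at a1
    linear_combination a1
  · have b5 : partialX (fun s z => u s z * ρ s z) t x = partialX u t x * ρ t x + u t x * partialX ρ t x :=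
      ((hu.hasX (m t) x).fun_mul (hρ.hasX (m t) x)).deriv
    rw [b5]
    obtain ⟨ξ, rfl⟩ := hsurj t x
    have d1 := (ct hρ t ξ).fun_mul (pt t ξ)
    have d2 : HasDerivAt (fun s => ρ s (y s ξ) * p s ξ) 0 t := by
      simp only [hR]; exact hasDerivAt_const _ _
    have d3 := d1.unique d2
    refine mul_right_cancel₀ (hp t ξ).ne' ?_
    rw [← e1] at d3
    rw [zero_mul, hU]
    linear_combination d3

end TCH

namespace TCH

theorem inverse_smooth {y p : ℝ → ℝ → ℝ} (hy : ContDiff ℝ (⊤ : ℕ∞) (uncurry y))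
    (yx : ∀ t ξ, HasDerivAt (y t) (p t ξ) ξ) (hp : ∀ t ξ, 0 < p t ξ)
    (hsurj : ∀ t x, ∃ ξ, y t ξ = x) :
    ∃ X : ℝ → ℝ → ℝ, ContDiff ℝ (⊤ : ℕ∞) (uncurry X) ∧ (∀ t x, y t (X t x) = x) ∧
      (∀ t ξ, X t (y t ξ) = ξ) := by
  have hinj (t : ℝ) : Injective (y t) :=
    (strictMono_of_hasDerivAt_pos (yx t) (hp t)).injective
  let Ψ : ℝ × ℝ → ℝ × ℝ := fun v => (v.1, uncurry y v)
  have hΨ : ContDiff ℝ (⊤ : ℕ∞) Ψ := contDiff_fst.prodMk hy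
  let D : ℝ × ℝ → (ℝ × ℝ →L[ℝ] ℝ) := fun v => fderiv ℝ (uncurry y) v
  have hD (v : ℝ × ℝ) : HasFDerivAt (uncurry y) (D v) v :=
    (hy.differentiable (by simp) v).hasFDerivAt
  have hDp (v : ℝ × ℝ) : D v (0, 1) = p v.1 v.2 := by
    have h2 : HasDerivAt (fun z : ℝ => (v.1, z)) ((0:ℝ), (1:ℝ)) v.2 :=
      (hasDerivAt_const v.2 v.1).prodMk (hasDerivAt_id v.2)
    have h3 : HasDerivAt (fun z => y v.1 z) (D v (0, 1)) v.2 :=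
      HasFDerivAt.comp_hasDerivAt (l := uncurry y) v.2 (hD v) h2
    exact h3.unique (yx v.1 v.2)
  obtain ⟨c, hsplit⟩ : ∃ c : ℝ × ℝ → ℝ, ∀ v a b, D v (a, b) = a * c v + b * p v.1 v.2 := by
    refine ⟨fun v => D v (1, 0), fun v a b => ?_⟩
    have : ((a, b) : ℝ × ℝ) = a • ((1:ℝ), (0:ℝ)) + b • ((0:ℝ), (1:ℝ)) := by simp
    rw [this, map_add, map_smul, map_smul, hDp, smul_eq_mul, smul_eq_mul]
  let f1 : ℝ × ℝ → (ℝ × ℝ →L[ℝ] ℝ × ℝ) := fun v =>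
    (ContinuousLinearMap.fst ℝ ℝ ℝ).prod (D v)
  let f2 : ℝ × ℝ → (ℝ × ℝ →L[ℝ] ℝ × ℝ) := fun v =>
    (ContinuousLinearMap.fst ℝ ℝ ℝ).prod ((p v.1 v.2)⁻¹ • (ContinuousLinearMap.snd ℝ ℝ ℝ
      - (c v) • ContinuousLinearMap.fst ℝ ℝ ℝ))
  let L : ℝ × ℝ → ((ℝ × ℝ) ≃L[ℝ] (ℝ × ℝ)) := fun v =>
    ContinuousLinearEquiv.equivOfInverse (f1 v) (f2 v)
      (by
        rintro ⟨a, b⟩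
        have := (hp v.1 v.2).ne'
        simp only [f1, f2, ContinuousLinearMap.prod_apply, ContinuousLinearMap.coe_fst',
          _root_.smul_apply, _root_.sub_apply,
          ContinuousLinearMap.coe_snd', smul_eq_mul, hsplit, Prod.mk.injEq, true_and]
        field_simp
        ring)
      (by
        rintro ⟨a, b⟩
        have := (hp v.1 v.2).ne'
        simp only [f1, f2, ContinuousLinearMap.prod_apply, ContinuousLinearMap.coe_fst',
          _root_.smul_apply, _root_.sub_apply,
          ContinuousLinearMap.coe_snd', smul_eq_mul, hsplit, Prod.mk.injEq, true_and]
        field_simp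
        ring)
  have hL (v : ℝ × ℝ) : HasFDerivAt Ψ (L v : ℝ × ℝ →L[ℝ] ℝ × ℝ) v := by
    have : HasFDerivAt Ψ (f1 v) v := hasFDerivAt_fst.prodMk (hD v)
    exact this
  have hS (v : ℝ × ℝ) : HasStrictFDerivAt Ψ (L v : ℝ × ℝ →L[ℝ] ℝ × ℝ) v :=
    hΨ.contDiffAt.hasStrictFDerivAt' (hL v) (by simp)
  have hbij : Bijective Ψ := by
    constructor
    · rintro ⟨a, b⟩ ⟨c, e⟩ h
      simp only [Ψ, uncurry, Prod.mk.injEq] at h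
      obtain ⟨rfl, h⟩ := h
      rw [hinj a h]
    · rintro ⟨a, b⟩
      obtain ⟨ξ, h⟩ := hsurj a b
      exact ⟨(a, ξ), by simp [Ψ, uncurry, h]⟩
  let e : ℝ × ℝ ≃ ℝ × ℝ := Equiv.ofBijective Ψ hbij
  let H : ℝ × ℝ ≃ₜ ℝ × ℝ := e.toHomeomorphOfContinuousOpen hΨ.continuous
    (isOpenMap_of_hasStrictFDerivAt_equiv hS)
  have hH : ContDiff ℝ (⊤ : ℕ∞) (H.symm : ℝ × ℝ → ℝ × ℝ) := H.contDiff_symm (f₀' := L) hL hΨ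
  have h1 (t x : ℝ) : Ψ (H.symm (t, x)) = (t, x) := H.apply_symm_apply (t, x)
  have h2 (t x : ℝ) : y t (H.symm (t, x)).2 = x := by
    have := h1 t x
    simp only [Ψ, uncurry, Prod.mk.injEq] at this
    rw [this.1] at this; exact this.2
  refine ⟨fun t x => (H.symm (t, x)).2, ?_, h2, fun t ξ => hinj t (h2 t _)⟩
  exact contDiff_snd.comp hH

end TCH

namespace TCH

theorem Tau_contDiff {x0 : EE} (h : ∀ i, ContDiff ℝ (⊤ : ℕ∞) (fun s => tau s (x0 i))) :
    ContDiff ℝ (⊤ : ℕ∞) (fun s => Tau s x0) := by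
  rw [contDiff_pi]
  intro i
  exact h i

theorem init_data {u0 ρ0 : ℝ → ℝ} (hu0 : ContDiff ℝ (⊤ : ℕ∞) u0) (hρ0 : ContDiff ℝ (⊤ : ℕ∞) ρ0)
    (hu0p : ∀ x, u0 (x + 1) = u0 x) (hρ0p : ∀ x, ρ0 (x + 1) = ρ0 x) :
    ∃ (x0 : EE) (h : ℝ), Inv h (fun ξ => ρ0 ξ ^ 2) x0 ∧ (∀ ξ, x0 4 ξ = 1) ∧
      (∀ ξ, x0 0 ξ = 0) ∧ (∀ ξ, x0 3 ξ = u0 ξ) ∧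
      ContDiff ℝ (⊤ : ℕ∞) (fun s => Tau s x0) := by
  have hd : ContDiff ℝ (⊤ : ℕ∞) (deriv u0) := ((contDiff_infty_iff_deriv).1 hu0).2
  have hdp := per_deriv hu0p
  have hn : ContDiff ℝ (⊤ : ℕ∞) (fun x => u0 x ^ 2 + deriv u0 x ^ 2 + ρ0 x ^ 2) :=
    ((hu0.pow 2).add (hd.pow 2)).add (hρ0.pow 2)
  have hnp : ∀ x, (fun x => u0 x ^ 2 + deriv u0 x ^ 2 + ρ0 x ^ 2) (x + 1) =
      (fun x => u0 x ^ 2 + deriv u0 x ^ 2 + ρ0 x ^ 2) x := by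
    intro x; simp only [hu0p, hρ0p, hdp]
  let x0 : EE := ![0, 1, 1, pb u0 hu0.continuous hu0p, 1, pb (deriv u0) hd.continuous hdp,
    pb _ hn.continuous hnp]
  have e0 (ξ : ℝ) : x0 0 ξ = 0 := rfl
  have e1 (ξ : ℝ) : x0 1 ξ = 1 := rfl
  have e2 (ξ : ℝ) : x0 2 ξ = 1 := rfl
  have e3 (ξ : ℝ) : x0 3 ξ = u0 ξ := rfl
  have e4 (ξ : ℝ) : x0 4 ξ = 1 := rfl
  have e5 (ξ : ℝ) : x0 5 ξ = deriv u0 ξ := rfl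
  have e6 (ξ : ℝ) : x0 6 ξ = u0 ξ ^ 2 + deriv u0 ξ ^ 2 + ρ0 ξ ^ 2 := rfl
  refine ⟨x0, _, ⟨?_, ?_, ?_, ?_, ?_, ?_, ?_, rfl⟩, e4, e0, e3, ?_⟩
  · intro i ξ
    fin_cases i
    · rfl
    · rfl
    · rfl
    · exact hu0p ξ
    · rfl
    · exact hdp ξ
    · exact hnp ξ
  · intro ξ; rw [e0, e1]; simp
  · intro ξ; rw [e0, e2]; simp
  · intro ξ
    rw [e4, sub_self]
    exact hasDerivAt_const ξ (0:ℝ)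
  · intro ξ
    exact (hu0.differentiable (by simp) ξ).hasDerivAt
  · intro ξ
    rw [e3, e4, e5, e6]; ring
  · intro ξ; rw [e4]; exact one_pos
  · apply Tau_contDiff
    have c0 : ContDiff ℝ (⊤ : ℕ∞) (fun s => tau s (0 : B)) := by
      simp only [map_zero]; exact contDiff_const
    have c1 : ContDiff ℝ (⊤ : ℕ∞) (fun s => tau s (1 : B)) := by
      simp only [map_one]; exact contDiff_const
    intro i
    fin_cases i
    · exact c0
    · exact c1
    · exact c1
    · exact tau_contDiff hu0 hu0p
    · exact c1
    · exact tau_contDiff hd hdp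
    · exact tau_contDiff hn hnp

theorem existence {u0 ρ0 : ℝ → ℝ} (hu0 : ContDiff ℝ (⊤ : ℕ∞) u0) (hρ0 : ContDiff ℝ (⊤ : ℕ∞) ρ0)
    (hu0p : ∀ x, u0 (x + 1) = u0 x) (hρ0p : ∀ x, ρ0 (x + 1) = ρ0 x)
    (hpos : ∀ x, 0 < (ρ0 x)^2) :
    ∃ u ρ : ℝ → ℝ → ℝ, Sm univ u ∧ Sm univ ρ ∧
      (∀ t x, u t (x + 1) = u t x ∧ ρ t (x + 1) = ρ t x) ∧
      (∀ x, u 0 x = u0 x ∧ ρ 0 x = ρ0 x) ∧ Is2CH 0 1 u ρ := by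
  obtain ⟨x0, h, hI, h4, h0, h3, hs⟩ := init_data hu0 hρ0 hu0p hρ0p
  obtain ⟨z, hz0, hzt, hzs, hzI⟩ := lagrangian hI hpos h4 hs
  let y : ℝ → ℝ → ℝ := fun t ξ => ξ + z t 0 ξ
  have hy : ContDiff ℝ (⊤ : ℕ∞) (uncurry y) := contDiff_snd.add (hzs 0)
  have yx (t ξ : ℝ) : HasDerivAt (y t) (z t 4 ξ) ξ := (hzI t).dy ξ
  have hp (t ξ : ℝ) : 0 < z t 4 ξ := (hzI t).p ξ
  have zt (t : ℝ) (i : Fin 7) (ξ : ℝ) : HasDerivAt (fun s => z s i ξ) (F (z t) i ξ) t :=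
    (evE i ξ).hasFDerivAt.comp_hasDerivAt t (hzt t)
  have hsurj (t x : ℝ) : ∃ ξ, y t ξ = x := by
    have hc : Continuous (y t) := by
      have := (z t 0).continuous
      exact continuous_id.add this
    have hb (ξ : ℝ) : |z t 0 ξ| ≤ ‖z t 0‖ := (z t 0).norm_coe_le_norm ξ
    have := intermediate_value_Icc (a := x - ‖z t 0‖) (b := x + ‖z t 0‖)
      (by linarith [norm_nonneg (z t 0)]) hc.continuousOn
    obtain ⟨ξ, -, hξ⟩ := this (show x ∈ Icc _ _ from by
      constructor
      · have := (abs_le.1 (hb (x - ‖z t 0‖))).2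
        simp only [y]; linarith
      · have := (abs_le.1 (hb (x + ‖z t 0‖))).1
        simp only [y]; linarith)
    exact ⟨ξ, hξ⟩
  obtain ⟨X, hX, hyX, hXy⟩ := inverse_smooth hy yx hp hsurj
  have hpair : ContDiff ℝ (⊤ : ℕ∞) (fun v : ℝ × ℝ => (v.1, uncurry X v)) := contDiff_fst.prodMk hX
  let u : ℝ → ℝ → ℝ := fun t x => z t 3 (X t x)
  let ρ : ℝ → ℝ → ℝ := fun t x => ρ0 (X t x) / z t 4 (X t x)
  have hu : ContDiff ℝ (⊤ : ℕ∞) (uncurry u) := (hzs 3).comp hpair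
  have hρ : ContDiff ℝ (⊤ : ℕ∞) (uncurry ρ) :=
    (hρ0.comp hX).div ((hzs 4).comp hpair) (fun v => (hp _ _).ne')
  have hXp (t x : ℝ) : X t (x + 1) = X t x + 1 := by
    have : y t (X t x + 1) = x + 1 := by
      have := hyX t x
      simp only [y] at this ⊢
      rw [(hzI t).per]; linarith
    rw [← this, hXy]
  have hX0 (x : ℝ) : X 0 x = x := by
    have : y 0 x = x := by simp only [y]; rw [hz0, h0]; simp
    conv_lhs => rw [← this, hXy]
  refine ⟨u, ρ, hu.contDiffOn, hρ.contDiffOn, ?_, ?_, ?_⟩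
  · intro t x
    simp only [u, ρ, hXp, (hzI t).per, hρ0p, and_self]
  · intro x
    simp only [u, ρ, hX0, hz0, h3, h4, div_one, and_self]
  · refine euler_eqs (y := y) (U := fun t => z t 3) (p := fun t => z t 4) (q := fun t => z t 5)
      (ν := fun t => z t 6) (P := fun t => PP (z t)) (Q := fun t => QQ (z t)) (R := ρ0)
      hu.contDiffOn hρ.contDiffOn hsurj hp yx ?_ ?_ ?_ ?_ ?_ ?_ ?_ ?_ ?_
    · intro t ξ
      exact (zt t 0 ξ).const_add ξ
    · intro t ξ; exact (hzI t).U' ξ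
    · intro t ξ; exact zt t 3 ξ
    · intro t ξ; exact zt t 4 ξ
    · intro t ξ
      have := (PQ_hasDerivAt (hzI t).per (hzI t).a (hzI t).b ((hzI t).w' ξ)).1
      simpa using this
    · intro t ξ
      have := (PQ_hasDerivAt (hzI t).per (hzI t).a (hzI t).b ((hzI t).w' ξ)).2
      refine this.congr_deriv ?_
      rw [vff_pt]; ring
    · intro t ξ
      have := (hzI t).inv ξ
      linarith
    · intro t ξ
      simp only [u, hXy]
    · intro t ξ
      simp only [ρ, hXy]
      exact div_mul_cancel₀ _ (hp t ξ).ne'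

end TCH

namespace TCH

theorem Sm.contX {A : Set ℝ} {u : ℝ → ℝ → ℝ} (hu : Sm A u) {t : ℝ} (ht : t ∈ A) :
    Continuous (fun x => u t x) :=
  continuous_iff_continuousAt.2 fun x => (hu.hasX ht x).continuousAt

theorem Sm.bound {A : Set ℝ} {u : ℝ → ℝ → ℝ} (hu : Sm A u) {a b : ℝ} (h : Icc a b ⊆ A) :
    ∃ C, 0 ≤ C ∧ ∀ t ∈ Icc a b, ∀ x ∈ Icc (0:ℝ) 1, |u t x| ≤ C := by
  have hc : ContinuousOn (uncurry u) (Icc a b ×ˢ Icc (0:ℝ) 1) :=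
    (ContDiffOn.continuousOn hu).mono (prod_mono h (subset_univ _))
  obtain ⟨C, hC⟩ := (isCompact_Icc.prod isCompact_Icc).exists_bound_of_continuousOn hc
  refine ⟨max C 0, le_max_right _ _, fun t ht x hx => ?_⟩
  exact (hC (t, x) ⟨ht, hx⟩).trans (le_max_left _ _)

theorem energy_deriv {e : ℝ → ℝ → ℝ} (he : Sm (Ioi 0) e) {t : ℝ} (ht : 0 < t) :
    HasDerivAt (fun s => ∫ x in (0:ℝ)..1, e s x) (∫ x in (0:ℝ)..1, partialT e t x) t := by
  have hT := he.dT isOpen_Ioi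
  have hsub : Icc (t/2) (2*t) ⊆ Ioi (0:ℝ) := fun s hs => by
    have := hs.1
    simp only [mem_Ioi]; linarith
  obtain ⟨C, hC0, hC⟩ := hT.bound hsub
  have hu : uIoc (0:ℝ) 1 ⊆ Icc 0 1 := by
    rw [uIoc_of_le zero_le_one]; exact Ioc_subset_Icc_self
  refine (intervalIntegral.hasDerivAt_integral_of_dominated_loc_of_deriv_le (μ := volume)
    (F' := fun s x => partialT e s x) (bound := fun _ => C)
    (Icc_mem_nhds (show t/2 < t by linarith) (show t < 2*t by linarith)) ?_ ?_ ?_ ?_ ?_ ?_).2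
  · filter_upwards [Ioi_mem_nhds ht] with s hs
    exact (he.contX hs).aestronglyMeasurable
  · exact (he.contX (show t ∈ Ioi 0 from ht)).intervalIntegrable _ _
  · exact (hT.contX (show t ∈ Ioi 0 from ht)).aestronglyMeasurable
  · exact Eventually.of_forall fun x hx s hs => hC s hs x (hu hx)
  · exact intervalIntegrable_const
  · exact Eventually.of_forall fun x hx s hs => he.hasT isOpen_Ioi (hsub hs) x

theorem energy_cont {e : ℝ → ℝ → ℝ} (he : Sm (Ici 0) e) :
    ContinuousOn (fun s => ∫ x in (0:ℝ)..1, e s x) (Ici 0) := by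
  have hc : Continuous (uncurry fun t x => e (max 0 t) x) := by
    have h2 : Continuous (fun v : ℝ × ℝ => (max 0 v.1, v.2)) := by fun_prop
    exact (ContDiffOn.continuousOn he).comp_continuous h2 (fun v => ⟨mem_Ici.2 (le_max_left _ _), mem_univ _⟩)
  have := intervalIntegral.continuous_parametric_intervalIntegral_of_continuous'
    (μ := volume) hc (0:ℝ) 1
  refine this.continuousOn.congr fun s hs => ?_
  simp only [max_eq_right (show (0:ℝ) ≤ s from hs)]

/-- The flux function of the momentum equation. -/
noncomputable def MM (u ρ : ℝ → ℝ → ℝ) (t x : ℝ) : ℝ :=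
  3/2 * (u t x * u t x) - 1/2 * (partialX u t x * partialX u t x)
    - u t x * partialX (partialX u) t x + 1/2 * (ρ t x * ρ t x)

theorem MM_deriv {u ρ : ℝ → ℝ → ℝ} (hu : Sm (Ioi 0) u) (hρ : Sm (Ioi 0) ρ) (h : Is2CH 0 1 u ρ)
    {t : ℝ} (ht : 0 < t) (x : ℝ) :
    HasDerivAt (fun x => MM u ρ t x)
      (partialT (partialX (partialX u)) t x - partialT u t x) x := by
  have uu : UniqueDiffOn ℝ (Ioi (0:ℝ)) := isOpen_Ioi.uniqueDiffOn
  have m : t ∈ Ioi (0:ℝ) := ht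
  have u0 := hu.hasX m x
  have u1 := (hu.dX uu).hasX m x
  have u2 := ((hu.dX uu).dX uu).hasX m x
  have r0 := hρ.hasX m x
  refine (((((u0.fun_mul u0).const_mul (3/2)).fun_sub ((u1.fun_mul u1).const_mul (1/2))).fun_sub
    (u0.fun_mul u2)).fun_add ((r0.fun_mul r0).const_mul (1/2))).congr_deriv ?_
  have := (h t ht x).1
  linear_combination this

theorem rho_eq {u ρ : ℝ → ℝ → ℝ} (hu : Sm (Ioi 0) u) (hρ : Sm (Ioi 0) ρ) (h : Is2CH 0 1 u ρ)
    {t : ℝ} (ht : 0 < t) (x : ℝ) :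
    partialT ρ t x = -(partialX u t x * ρ t x + u t x * partialX ρ t x) := by
  have m : t ∈ Ioi (0:ℝ) := ht
  have h1 := (h t ht x).2
  have b5 : partialX (fun s z => u s z * ρ s z) t x = partialX u t x * ρ t x + u t x * partialX ρ t x :=
      ((hu.hasX m x).fun_mul (hρ.hasX m x)).deriv
  rw [b5] at h1
  linarith

theorem uniqueness {u ρ v σ : ℝ → ℝ → ℝ} (hu : Sm (Ici 0) u) (hρ : Sm (Ici 0) ρ)
    (hv : Sm (Ici 0) v) (hσ : Sm (Ici 0) σ)
    (hup : ∀ t, 0 ≤ t → ∀ x, u t (x + 1) = u t x ∧ ρ t (x + 1) = ρ t x)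
    (hvp : ∀ t, 0 ≤ t → ∀ x, v t (x + 1) = v t x ∧ σ t (x + 1) = σ t x)
    (h0 : ∀ x, v 0 x = u 0 x ∧ σ 0 x = ρ 0 x)
    (h1 : Is2CH 0 1 u ρ) (h2 : Is2CH 0 1 v σ) :
    ∀ t, 0 ≤ t → ∀ x, v t x = u t x ∧ σ t x = ρ t x := by
  have uC : UniqueDiffOn ℝ (Ici (0:ℝ)) := uniqueDiffOn_Ici 0
  have uO : UniqueDiffOn ℝ (Ioi (0:ℝ)) := isOpen_Ioi.uniqueDiffOn
  have oO : IsOpen (Ioi (0:ℝ)) := isOpen_Ioi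
  have hux := hu.dX uC
  have hvx := hv.dX uC
  have huxx := hux.dX uC
  have hrx := hρ.dX uC
  have sub : Ioi (0:ℝ) ⊆ Ici 0 := Ioi_subset_Ici_self
  have ou := hu.mono sub
  have ov := hv.mono sub
  have oux := hux.mono sub
  have ovx := hvx.mono sub
  have oρ := hρ.mono sub
  have oσ := hσ.mono sub
  let e : ℝ → ℝ → ℝ := fun t x => (v t x - u t x) * (v t x - u t x)
    + (partialX v t x - partialX u t x) * (partialX v t x - partialX u t x)
    + (σ t x - ρ t x) * (σ t x - ρ t x)
  have he : Sm (Ici 0) e := (((hv.sub hu).mul (hv.sub hu)).add ((hvx.sub hux).mul (hvx.sub hux))).add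
    ((hσ.sub hρ).mul (hσ.sub hρ))
  have heO := he.mono sub
  -- coefficients
  let a1 : ℝ → ℝ → ℝ := fun t x => 3 * (v t x + u t x) - 2 * partialX (partialX u) t x
  have ha1 : Sm (Ici 0) a1 := ((Sm.cst 3).mul (hv.add hu)).sub ((Sm.cst 2).mul huxx)
  let G : ℝ → ℝ → ℝ := fun t x =>
    a1 t x * ((v t x - u t x) * (partialX v t x - partialX u t x))
    - partialX u t x * ((partialX v t x - partialX u t x) * (partialX v t x - partialX u t x))
    + (σ t x - ρ t x) * ((σ t x - ρ t x) * (partialX v t x - partialX u t x))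
    - partialX v t x * ((σ t x - ρ t x) * (σ t x - ρ t x))
    - 2 * partialX ρ t x * ((v t x - u t x) * (σ t x - ρ t x))
  have hG : Sm (Ici 0) G := ((((ha1.mul ((hv.sub hu).mul (hvx.sub hux))).sub
    (hux.mul ((hvx.sub hux).mul (hvx.sub hux)))).add
    ((hσ.sub hρ).mul ((hσ.sub hρ).mul (hvx.sub hux)))).sub
    (hvx.mul ((hσ.sub hρ).mul (hσ.sub hρ)))).sub
    (((Sm.cst 2).mul hrx).mul ((hv.sub hu).mul (hσ.sub hρ)))
  let J : ℝ → ℝ → ℝ := fun t x =>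
    2 * ((v t x - u t x) * (partialT (partialX v) t x - partialT (partialX u) t x))
    - 2 * ((v t x - u t x) * (MM v σ t x - MM u ρ t x))
    - v t x * ((partialX v t x - partialX u t x) * (partialX v t x - partialX u t x))
    - v t x * ((σ t x - ρ t x) * (σ t x - ρ t x))
  have hJ (t : ℝ) (ht : 0 < t) (x : ℝ) :
      HasDerivAt (fun x => J t x) (partialT e t x - G t x) x := by
    have m : t ∈ Ioi (0:ℝ) := ht
    have dv := ov.hasX m x
    have du := ou.hasX m x
    have dvx := ovx.hasX m x
    have dux := oux.hasX m x
    have dvt := (ovx.dT oO).hasX m x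
    have dut := (oux.dT oO).hasX m x
    have dσ := oσ.hasX m x
    have dρ := oρ.hasX m x
    have V := dv.fun_sub du
    have W := dvx.fun_sub dux
    have S := dσ.fun_sub dρ
    have M2 := MM_deriv ov oσ h2 ht x
    have M1 := MM_deriv ou oρ h1 ht x
    have te : partialT e t x = _ :=
      (((((ov.hasT oO m x).fun_sub (ou.hasT oO m x)).fun_mul
        ((ov.hasT oO m x).fun_sub (ou.hasT oO m x))).fun_add
      (((ovx.hasT oO m x).fun_sub (oux.hasT oO m x)).fun_mul
        ((ovx.hasT oO m x).fun_sub (oux.hasT oO m x)))).fun_add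
      (((oσ.hasT oO m x).fun_sub (oρ.hasT oO m x)).fun_mul
        ((oσ.hasT oO m x).fun_sub (oρ.hasT oO m x)))).deriv
    refine (((((V.fun_mul (dvt.fun_sub dut)).const_mul 2).fun_sub
      ((V.fun_mul (M2.fun_sub M1)).const_mul 2)).fun_sub
      (dv.fun_mul (W.fun_mul W))).fun_sub (dv.fun_mul (S.fun_mul S))).congr_deriv ?_
    rw [te, ← ovx.comm oO m, ← oux.comm oO m, rho_eq ov oσ h2 ht, rho_eq ou oρ h1 ht]
    simp only [G, a1, MM]
    ring
  -- periodicity of the flux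
  have perX {f : ℝ → ℝ → ℝ} (hf : ∀ t, 0 ≤ t → ∀ x, f t (x + 1) = f t x) :
      ∀ t, 0 ≤ t → ∀ x, partialX f t (x + 1) = partialX f t x :=
    fun t ht x => per_deriv (hf t ht) x
  have perT {f : ℝ → ℝ → ℝ} (hf : ∀ t, 0 ≤ t → ∀ x, f t (x + 1) = f t x) :
      ∀ t, 0 < t → ∀ x, partialT f t (x + 1) = partialT f t x := by
    intro t ht x
    apply Filter.EventuallyEq.deriv_eq
    filter_upwards [Ioi_mem_nhds ht] with s hs
    exact hf s (le_of_lt hs) x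
  have pu : ∀ t, 0 ≤ t → ∀ x, u t (x + 1) = u t x := fun t ht x => (hup t ht x).1
  have pv : ∀ t, 0 ≤ t → ∀ x, v t (x + 1) = v t x := fun t ht x => (hvp t ht x).1
  have pρ : ∀ t, 0 ≤ t → ∀ x, ρ t (x + 1) = ρ t x := fun t ht x => (hup t ht x).2
  have pσ : ∀ t, 0 ≤ t → ∀ x, σ t (x + 1) = σ t x := fun t ht x => (hvp t ht x).2
  have hJp (t : ℝ) (ht : 0 < t) : J t 1 = J t 0 := by
    have h01 : (1:ℝ) = 0 + 1 := by norm_num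
    rw [h01]
    simp only [J, MM]
    rw [pu t ht.le, pv t ht.le, pρ t ht.le, pσ t ht.le, perX pu t ht.le, perX pv t ht.le,
      perX (perX pu) t ht.le, perX (perX pv) t ht.le, perT (perX pu) t ht, perT (perX pv) t ht]
  have hE' (t : ℝ) (ht : 0 < t) : ∫ x in (0:ℝ)..1, partialT e t x = ∫ x in (0:ℝ)..1, G t x := by
    have m : t ∈ Ioi (0:ℝ) := ht
    have c1 := (heO.dT oO).contX m
    have c2 := hG.contX (sub m)
    have := intervalIntegral.integral_eq_sub_of_hasDerivAt (a := 0) (b := 1)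
      (fun x _ => hJ t ht x) ((c1.sub c2).intervalIntegrable _ _)
    rw [hJp t ht, sub_self, intervalIntegral.integral_sub (c1.intervalIntegrable _ _)
      (c2.intervalIntegrable _ _)] at this
    linarith
  -- vanishing of the energy
  have hE0 : ∀ T, 0 ≤ T → ∫ x in (0:ℝ)..1, e T x = 0 := by
    intro T hT
    have hs : Icc 0 T ⊆ Ici (0:ℝ) := Icc_subset_Ici_self
    obtain ⟨C1, p1, b1⟩ := ha1.bound hs
    obtain ⟨C2, p2, b2⟩ := hux.bound hs
    obtain ⟨C3, p3, b3⟩ := (hσ.sub hρ).bound hs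
    obtain ⟨C4, p4, b4⟩ := hvx.bound hs
    obtain ⟨C5, p5, b5⟩ := hrx.bound hs
    have key := gron (K := C1 + C2 + C3 + C4 + 2 * C5) (T := T)
      (f := fun s => ∫ x in (0:ℝ)..1, e s x)
      (f' := fun s => ∫ x in (0:ℝ)..1, partialT e s x)
      ((energy_cont he).mono hs) (fun r hr => energy_deriv heO hr.1) (by
        intro r hr
        rw [hE' r hr.1, ← intervalIntegral.integral_const_mul]
        have mr : r ∈ Ici (0:ℝ) := hr.1.le
        have mr' : r ∈ Icc 0 T := ⟨hr.1.le, hr.2.le⟩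
        refine intervalIntegral.integral_mono_on zero_le_one ((hG.contX mr).intervalIntegrable _ _)
          (((he.contX mr).const_mul _).intervalIntegrable _ _) ?_
        intro x hx
        have i1 := b1 r mr' x hx
        have i2 := b2 r mr' x hx
        have i3 := b3 r mr' x hx
        have i4 := b4 r mr' x hx
        have i5 := b5 r mr' x hx
        simp only [G, e]
        generalize a1 r x = A1 at *
        generalize v r x - u r x = V at *
        generalize σ r x - ρ r x = S at *
        generalize partialX ρ r x = R at *
        generalize partialX v r x = v' at *
        generalize partialX u r x = u' at *
        generalize v' - u' = W at *
        have gen (c C X Y : ℝ) (hc : |c| ≤ C) (hXY : |X| ≤ Y) : c * X ≤ C * Y :=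
          (le_abs_self _).trans (by rw [abs_mul]; exact mul_le_mul hc hXY (abs_nonneg _) ((abs_nonneg _).trans hc))
        have gen' (c C X Y : ℝ) (hc : |c| ≤ C) (hXY : |X| ≤ Y) : -(c * X) ≤ C * Y := by
          have := gen (-c) C X Y (by rwa [abs_neg]) hXY
          linarith
        have q1 : |V * W| ≤ V * V + W * W + S * S := by
          rw [abs_le]; constructor <;> nlinarith [sq_nonneg (V - W), sq_nonneg (V + W), sq_nonneg S]
        have q2 : |W * W| ≤ V * V + W * W + S * S := by
          rw [abs_le]; constructor <;> nlinarith [sq_nonneg V, sq_nonneg W, sq_nonneg S]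
        have q3 : |S * W| ≤ V * V + W * W + S * S := by
          rw [abs_le]; constructor <;> nlinarith [sq_nonneg (S - W), sq_nonneg (S + W), sq_nonneg V]
        have q4 : |S * S| ≤ V * V + W * W + S * S := by
          rw [abs_le]; constructor <;> nlinarith [sq_nonneg V, sq_nonneg W, sq_nonneg S]
        have q5 : |V * S| ≤ V * V + W * W + S * S := by
          rw [abs_le]; constructor <;> nlinarith [sq_nonneg (V - S), sq_nonneg (V + S), sq_nonneg W]
        have g1 := gen _ _ _ _ i1 q1
        have g2 := gen' _ _ _ _ i2 q2
        have g3 := gen _ _ _ _ i3 q3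
        have g4 := gen' _ _ _ _ i4 q4
        have g5 := gen' _ _ _ _ i5 q5
        linarith)
    have k1 := key T ⟨hT, le_rfl⟩
    have z0 : ∫ x in (0:ℝ)..1, e 0 x = 0 := by
      have : ∀ x, e 0 x = 0 := by
        intro x
        have hd : partialX v 0 x = partialX u 0 x := by
          simp only [partialX]
          congr 1; ext z; exact (h0 z).1
        simp only [e, (h0 x).1, (h0 x).2, hd]; ring
      simp [this]
    rw [z0, zero_mul] at k1
    refine le_antisymm k1 (intervalIntegral.integral_nonneg zero_le_one fun x _ => ?_)
    exact add_nonneg (add_nonneg (mul_self_nonneg _) (mul_self_nonneg _)) (mul_self_nonneg _)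
  -- conclusion
  intro t ht x
  have en (x : ℝ) : 0 ≤ e t x :=
    add_nonneg (add_nonneg (mul_self_nonneg _) (mul_self_nonneg _)) (mul_self_nonneg _)
  have hc := he.contX (show t ∈ Ici 0 from ht)
  have hep : Function.Periodic (fun x => e t x) 1 := by
    intro x
    simp only [e]
    rw [pu t ht, pv t ht, pρ t ht, pσ t ht, perX pu t ht, perX pv t ht]
  have hIntg : ∫ y in (x)..(x+1), e t y = 0 := by
    have := hep.intervalIntegral_add_eq x 0
    rw [zero_add] at this
    rw [this, hE0 t ht]
  have hz : e t x = 0 := by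
    by_contra hne
    have hpos : 0 < e t x := lt_of_le_of_ne (en x) (Ne.symm hne)
    have := intervalIntegral.integral_pos (a := x) (b := x + 1) (by linarith) hc.continuousOn
      (fun y _ => en y) ⟨x, ⟨le_rfl, by linarith⟩, hpos⟩
    linarith
  have s1 := mul_self_nonneg (v t x - u t x)
  have s2 := mul_self_nonneg (partialX v t x - partialX u t x)
  have s3 := mul_self_nonneg (σ t x - ρ t x)
  simp only [e] at hz
  constructor
  · have : (v t x - u t x) * (v t x - u t x) = 0 := by linarith
    linarith [mul_self_eq_zero.1 this]
  · have : (σ t x - ρ t x) * (σ t x - ρ t x) = 0 := by linarith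
    linarith [mul_self_eq_zero.1 this]

end TCH

/-- If `u₀, ρ₀ ∈ C^∞(ℝ)` are periodic of period 1 and `ρ₀² ≥ d > 0`, then there is a
unique classical solution `u, ρ ∈ C^∞([0,∞) × ℝ)`, periodic of period 1 in `x`, of the
2CH system (with `κ = 0`, `η = 1`) with initial data `(u₀,ρ₀)`. -/
theorem smooth_global_solution_2CH (u0 ρ0 : ℝ → ℝ)
    (hu0 : ContDiff ℝ (⊤ : ℕ∞) u0) (hρ0 : ContDiff ℝ (⊤ : ℕ∞) ρ0)
    (hu0p : ∀ x, u0 (x + 1) = u0 x) (hρ0p : ∀ x, ρ0 (x + 1) = ρ0 x)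
    (d : ℝ) (hd : 0 < d) (hlb : ∀ x, d ≤ (ρ0 x)^2) :
    ∃ u ρ : ℝ → ℝ → ℝ,
      (ContDiffOn ℝ (⊤ : ℕ∞) (Function.uncurry u) (Set.Ici 0 ×ˢ Set.univ) ∧
       ContDiffOn ℝ (⊤ : ℕ∞) (Function.uncurry ρ) (Set.Ici 0 ×ˢ Set.univ) ∧
       (∀ t, 0 ≤ t → ∀ x, u t (x + 1) = u t x ∧ ρ t (x + 1) = ρ t x) ∧
       (∀ x, u 0 x = u0 x ∧ ρ 0 x = ρ0 x) ∧
       Is2CH 0 1 u ρ) ∧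
      (∀ u' ρ' : ℝ → ℝ → ℝ,
        (ContDiffOn ℝ (⊤ : ℕ∞) (Function.uncurry u') (Set.Ici 0 ×ˢ Set.univ) ∧
         ContDiffOn ℝ (⊤ : ℕ∞) (Function.uncurry ρ') (Set.Ici 0 ×ˢ Set.univ) ∧
         (∀ t, 0 ≤ t → ∀ x, u' t (x + 1) = u' t x ∧ ρ' t (x + 1) = ρ' t x) ∧
         (∀ x, u' 0 x = u0 x ∧ ρ' 0 x = ρ0 x) ∧
         Is2CH 0 1 u' ρ') →
        ∀ t, 0 ≤ t → ∀ x, u' t x = u t x ∧ ρ' t x = ρ t x) := by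
  have hpos : ∀ x, 0 < (ρ0 x)^2 := fun x => lt_of_lt_of_le hd (hlb x)
  obtain ⟨u, ρ, hu, hρ, hper, h0, hE⟩ := TCH.existence hu0 hρ0 hu0p hρ0p hpos
  have hu1 : TCH.Sm (Set.Ici 0) u := hu.mono (Set.subset_univ _)
  have hρ1 : TCH.Sm (Set.Ici 0) ρ := hρ.mono (Set.subset_univ _)
  refine ⟨u, ρ, ⟨hu1, hρ1, fun t _ x => hper t x, h0, hE⟩, ?_⟩
  rintro v σ ⟨hv, hσ, hvp, hv0, hvE⟩
  exact TCH.uniqueness hu1 hρ1 hv hσ (fun t _ x => hper t x) hvp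
    (fun x => ⟨(hv0 x).1.trans (h0 x).1.symm, (hv0 x).2.trans (h0 x).2.symm⟩) hE hvE
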